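/- There exists no smooth function I : T*U → ℝ which is polynomial in momenta of degree ≤ 6 such that the four functions H, p_φ, p_t, I are functionally independent and pairwise Poisson-commute. -/

import Mathlib

open Real Finset

noncomputable section

/-- A phase-space point `(x, y, φ, t, p_x, p_y, p_φ, p_t)` of `T*U ⊂ ℝ⁴ × ℝ⁴`. -/
abbrev PhasePt := Fin 8 → ℝ

/-- The phase space `T*U` over `U = {x > 1, -1 < y < 1}`. -/
def TStar : Set PhasePt := {z | 1 < z 0 ∧ -1 < z 1 ∧ z 1 < 1}

/-- The base domain `U`. -/
def Ubase : Set (Fin 4 → ℝ) := {w | 1 < w 0 ∧ -1 < w 1 ∧ w 1 < 1}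

/-- Projection to the base coordinates `(x, y, φ, t)`. -/
def basePt (z : PhasePt) : Fin 4 → ℝ := fun q => z ⟨q.1, by omega⟩

/-- Partial derivative in the `i`-th coordinate. -/
def pd (i : Fin 8) (f : PhasePt → ℝ) (z : PhasePt) : ℝ :=
  fderiv ℝ f z (Pi.single i 1)

/-- The canonical Poisson bracket on `T*U`. -/
def pois (f g : PhasePt → ℝ) (z : PhasePt) : ℝ :=
    (pd 0 f z * pd 4 g z - pd 4 f z * pd 0 g z)
  + (pd 1 f z * pd 5 g z - pd 5 f z * pd 1 g z)
  + (pd 2 f z * pd 6 g z - pd 6 f z * pd 2 g z)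
  + (pd 3 f z * pd 7 g z - pd 7 f z * pd 3 g z)

/-- The geodesic Hamiltonian of the Zipoy-Voorhees metric with parameter `δ = 2`. -/
def Ham (z : PhasePt) : ℝ :=
  (1/2) * ( (((z 0)^2 - 1) * (z 4)^2 + (1 - (z 1)^2) * (z 5)^2)
      / ((((z 0 + 1)/(z 0 - 1))^2) * (((z 0)^2 - 1)^4 / ((z 0)^2 - (z 1)^2)^3))
    + (z 6)^2 / ((((z 0 + 1)/(z 0 - 1))^2) * (((z 0)^2 - 1) * (1 - (z 1)^2)))
    - ((z 0 + 1)/(z 0 - 1))^2 * (z 7)^2 )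

/-- The momentum `p_φ`. -/
def Pphi (z : PhasePt) : ℝ := z 6

/-- The momentum `p_t`. -/
def Ptm (z : PhasePt) : ℝ := z 7

/-- `I` is polynomial in momenta of degree `≤ d`, with smooth coefficients. -/
def IsPolyMom (d : ℕ) (I : PhasePt → ℝ) : Prop :=
  ∃ c : ℕ → ℕ → ℕ → ℕ → ((Fin 4 → ℝ) → ℝ),
    (∀ i j k m, ContDiffOn ℝ (⊤ : ℕ∞) (c i j k m) Ubase) ∧
    ∀ z ∈ TStar, I z =
      ∑ i ∈ Finset.range (d+1), ∑ j ∈ Finset.range (d+1),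
      ∑ k ∈ Finset.range (d+1), ∑ m ∈ Finset.range (d+1),
        (if i + j + k + m ≤ d then
          c i j k m (basePt z) * (z 4)^i * (z 5)^j * (z 6)^k * (z 7)^m else 0)

/-- `I` is a homogeneous polynomial in momenta of degree `d`, with smooth coefficients. -/
def IsHomPolyMom (d : ℕ) (I : PhasePt → ℝ) : Prop :=
  ∃ c : ℕ → ℕ → ℕ → ℕ → ((Fin 4 → ℝ) → ℝ),
    (∀ i j k m, ContDiffOn ℝ (⊤ : ℕ∞) (c i j k m) Ubase) ∧
    ∀ z ∈ TStar, I z =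
      ∑ i ∈ Finset.range (d+1), ∑ j ∈ Finset.range (d+1),
      ∑ k ∈ Finset.range (d+1), ∑ m ∈ Finset.range (d+1),
        (if i + j + k + m = d then
          c i j k m (basePt z) * (z 4)^i * (z 5)^j * (z 6)^k * (z 7)^m else 0)

/-- Functional independence: the differentials are linearly independent at every point
of a dense subset of `T*U`. -/
def FunIndep (f₁ f₂ f₃ f₄ : PhasePt → ℝ) : Prop :=
  ∃ S : Set PhasePt, S ⊆ TStar ∧ TStar ⊆ closure S ∧
    ∀ z ∈ S, LinearIndependent ℝ
      ![fderiv ℝ f₁ z, fderiv ℝ f₂ z, fderiv ℝ f₃ z, fderiv ℝ f₄ z]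


/-! ### Part C: reflection machinery for the linear systems -/

/-- Value of an integer coefficient list (lowest degree first) at a real point. -/
def pev : List ℤ → ℝ → ℝ
  | [], _ => 0
  | c :: t, x => (c : ℝ) + x * pev t x

/-- Derivative value. -/
def pdv : List ℤ → ℝ → ℝ
  | [], _ => 0
  | _ :: t, x => pev t x + x * pdv t x

/-- Value at an integer. -/
def pevZ : List ℤ → ℤ → ℤ
  | [], _ => 0
  | c :: t, x => c + x * pevZ t x

def padd : List ℤ → List ℤ → List ℤ
  | [], b => b
  | a :: s, [] => a :: s
  | a :: s, b :: t => (a + b) :: padd s t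

def psc (c : ℤ) : List ℤ → List ℤ
  | [] => []
  | a :: s => (c * a) :: psc c s

/-- The operator `x d/dx` (with index offset). -/
def pxd : ℤ → List ℤ → List ℤ
  | _, [] => []
  | k, a :: s => (k * a) :: pxd (k + 1) s

/-- Multiplication by `c (x^2 - 2 x)`. -/
def pmq (c : ℤ) (B : List ℤ) : List ℤ := 0 :: padd (psc (-2 * c) B) (0 :: psc c B)

/-- Multiplication by `c (x^2 - 1)`. -/
def pmX (c : ℤ) (B : List ℤ) : List ℤ := padd (psc (-c) B) (0 :: 0 :: psc c B)

lemma pev_hasDerivAt (a : List ℤ) (x : ℝ) : HasDerivAt (pev a) (pdv a x) x := by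
  induction a with
  | nil => simpa [pev, pdv] using hasDerivAt_const x (0 : ℝ)
  | cons c t ih =>
    have h := ((hasDerivAt_id x).mul ih).const_add (c : ℝ)
    have e : pdv (c :: t) x = 1 * pev t x + id x * pdv t x := by simp [pdv]
    rw [e]
    exact h

lemma pev_padd (a b : List ℤ) (x : ℝ) : pev (padd a b) x = pev a x + pev b x := by
  induction a generalizing b with
  | nil => simp [padd, pev]
  | cons c t ih =>
    cases b with
    | nil => simp [padd, pev]
    | cons d u => simp only [padd, pev, ih]; push_cast; ring

lemma pev_psc (c : ℤ) (a : List ℤ) (x : ℝ) : pev (psc c a) x = c * pev a x := by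
  induction a with
  | nil => simp [psc, pev]
  | cons d u ih => simp only [psc, pev, ih]; push_cast; ring

lemma pev_pxd (k : ℤ) (a : List ℤ) (x : ℝ) :
    pev (pxd k a) x = k * pev a x + x * pdv a x := by
  induction a generalizing k with
  | nil => simp [pxd, pev, pdv]
  | cons d u ih => simp only [pxd, pev, pdv, ih]; push_cast; ring

lemma pev_pmq (c : ℤ) (a : List ℤ) (x : ℝ) :
    pev (pmq c a) x = c * (x * (x - 2)) * pev a x := by
  simp only [pmq, pev, pev_padd, pev_psc]; push_cast; ring

lemma pev_pmX (c : ℤ) (a : List ℤ) (x : ℝ) :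
    pev (pmX c a) x = c * (x ^ 2 - 1) * pev a x := by
  simp only [pmX, pev, pev_padd, pev_psc]; push_cast; ring

/-- A term of a linear form: shifted indices `(j+1, i+1)` and its coefficient. -/
abbrev LTerm := ℕ × ℕ × List ℤ

def evT (g : ℕ → ℕ → ℝ → ℝ) (r : List LTerm) (x : ℝ) : ℝ :=
  match r with
  | [] => 0
  | t :: s => pev t.2.2 x * g t.1 t.2.1 x + evT g s x

def coefOf (J I : ℕ) : List LTerm → List ℤ
  | [] => []
  | t :: s => if Nat.beq J t.1 && Nat.beq I t.2.1 then padd t.2.2 (coefOf J I s) else coefOf J I s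

def normR (V : List (ℕ × ℕ)) (r : List LTerm) : List LTerm :=
  V.map fun v => (v.1, v.2, coefOf v.1 v.2 r)

def stepT (n : ℤ) (t : LTerm) : List LTerm :=
  [ (t.1, t.2.1, padd (pmX 1 (pxd 0 t.2.2))
        (padd (pmq (1 - t.2.1) t.2.2) (psc (4 * (t.1 - 1)) t.2.2))),
    (t.1, t.2.1 + 2, pmq (-(t.2.1 + 1)) t.2.2),
    (t.1 - 1, t.2.1 + 1, pmX (t.1 - n - 2) t.2.2),
    (t.1 + 1, t.2.1 - 1, psc (-3 * t.1) t.2.2),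
    (t.1 + 1, t.2.1 + 1, 0 :: 0 :: psc t.1 t.2.2) ]

def stepR (n : ℤ) : List LTerm → List LTerm
  | [] => []
  | t :: s => stepT n t ++ stepR n s

/-- The starting constraint. -/
def conR (n : ℤ) (J : ℕ) : List LTerm :=
  [ (J, 2, [0, -2, 1]), (J - 1, 1, pmX (n - J + 2) [1]), (J + 1, 1, [0, 0, -(J : ℤ)]) ]

def rowsFrom (n : ℤ) (V : List (ℕ × ℕ)) : ℕ → List LTerm → List (List LTerm)
  | 0, _ => []
  | s + 1, r => r :: rowsFrom n V s (normR V (stepR n r))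

def rowsAll (n : ℤ) (V : List (ℕ × ℕ)) : List (ℕ × ℕ) → List (List LTerm)
  | [] => []
  | q :: t => rowsFrom n V q.2 (normR V (conR n q.1)) ++ rowsAll n V t

def varsL (n e : ℕ) : List (ℕ × ℕ) :=
  (List.range' 1 (n + 1)).flatMap fun J =>
    ((List.range' 1 (8 - J)).filter fun I => (I + J) % 2 == e).map fun I => (J, I)

structure Cert where
  x0 : ℤ
  p : ℕ
  sel : List (ℕ × ℕ)
  W : List (List ℤ)

def dotc (c : ℕ) : List ℤ → List (List ℤ) → ℤ
  | w :: ws, m :: ms => w * m.getD c 0 + dotc c ws ms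
  | _, _ => 0

def matL (R : List (List LTerm)) (x0 : ℤ) (p : ℕ) : List (List ℤ) :=
  R.map fun r => r.map fun t => pevZ t.2.2 x0 % (p : ℤ)

def chk (n e : ℕ) (C : Cert) : Bool :=
  let V := varsL n e
  let D := V.length
  let R := rowsAll n V C.sel
  let M := matL R C.x0 C.p
  (R.length == D) && (C.sel.all fun q => decide (1 ≤ q.1 ∧ q.1 ≤ n + 1)) && decide (1 < C.p) &&
    (List.range D).all fun r => (List.range D).all fun c =>
      dotc c (C.W.getD r []) M % (C.p : ℤ) == if r = c then 1 else 0


lemma sum_ite_key (V : List (ℕ × ℕ)) (hV : V.Nodup) (k : ℕ × ℕ) (a : ℝ) :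
    (V.map fun v => if v = k then a else 0).sum = if k ∈ V then a else 0 := by
  induction V with
  | nil => simp
  | cons v t ih =>
    rw [List.nodup_cons] at hV
    rw [List.map_cons, List.sum_cons, ih hV.2]
    by_cases h : v = k
    · subst h; simp [hV.1]
    · have h2 : k ≠ v := fun h3 => h h3.symm
      simp [h, h2]

lemma evT_map (g : ℕ → ℕ → ℝ → ℝ) (V : List (ℕ × ℕ)) (f : ℕ × ℕ → List ℤ) (x : ℝ) :
    evT g (V.map fun v => (v.1, v.2, f v)) x = (V.map fun v => pev (f v) x * g v.1 v.2 x).sum := by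
  induction V with
  | nil => simp [evT]
  | cons v t ih => simp [evT, ih]

lemma evT_normR (g : ℕ → ℕ → ℝ → ℝ) (V : List (ℕ × ℕ)) (hV : V.Nodup) (x : ℝ)
    (hz : ∀ J I, (J, I) ∉ V → g J I x = 0) (r : List LTerm) :
    evT g (normR V r) x = evT g r x := by
  rw [normR, evT_map]
  induction r with
  | nil => simp [coefOf, pev, evT]
  | cons t s ih =>
    rw [evT, ← ih]
    have h1 : ∀ v : ℕ × ℕ, pev (coefOf v.1 v.2 (t :: s)) x * g v.1 v.2 x
        = (if v = (t.1, t.2.1) then pev t.2.2 x * g t.1 t.2.1 x else 0)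
          + pev (coefOf v.1 v.2 s) x * g v.1 v.2 x := by
      rintro ⟨J, I⟩
      have hb : (Nat.beq J t.1 && Nat.beq I t.2.1) = true ↔ (J, I) = (t.1, t.2.1) := by
        rw [Bool.and_eq_true, Nat.beq_eq, Nat.beq_eq, Prod.mk.injEq]
      simp only [coefOf]
      by_cases h : (J, I) = (t.1, t.2.1)
      · rw [if_pos (hb.2 h), if_pos h, pev_padd]
        rw [Prod.mk.injEq] at h
        rw [← h.1, ← h.2]; ring
      · rw [if_neg (fun h' => h (hb.1 h')), if_neg h]; ring
    simp only [h1]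
    rw [List.sum_map_add, sum_ite_key V hV]
    split_ifs with h
    · rfl
    · rw [hz _ _ h]; ring

lemma evT_append (g : ℕ → ℕ → ℝ → ℝ) (a b : List LTerm) (x : ℝ) :
    evT g (a ++ b) x = evT g a x + evT g b x := by
  induction a with
  | nil => simp [evT]
  | cons t s ih => simp only [List.cons_append, evT, ih]; ring

/-- The differential system, in shifted indices. -/
def OdeSys (n : ℕ) (g : ℕ → ℕ → ℝ → ℝ) : Prop :=
  ∀ J I : ℕ, 1 ≤ J → 1 ≤ I → J ≤ n + 1 → ∀ x : ℝ, 1 < x →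
    ∃ d, HasDerivAt (g J I) d x ∧ x * (x ^ 2 - 1) * d =
      -(((I : ℝ) - 1) * (x * (x - 2)) - 4 * ((J : ℝ) - 1)) * g J I x
      - ((I : ℝ) + 1) * (x * (x - 2)) * g J (I + 2) x
      - ((n : ℝ) - J + 2) * (x ^ 2 - 1) * g (J - 1) (I + 1) x
      - 3 * J * g (J + 1) (I - 1) x + J * x ^ 2 * g (J + 1) (I + 1) x

/-- The algebraic constraints, in shifted indices. -/
def ConSys (n : ℕ) (g : ℕ → ℕ → ℝ → ℝ) : Prop :=
  ∀ J : ℕ, 1 ≤ J → J ≤ n + 1 → ∀ x : ℝ, 1 < x →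
    x * (x - 2) * g J 2 x + ((n : ℝ) - J + 2) * (x ^ 2 - 1) * g (J - 1) 1 x
      - J * x ^ 2 * g (J + 1) 1 x = 0

lemma evT_stepR (n : ℕ) (g : ℕ → ℕ → ℝ → ℝ) (ho : OdeSys n g) (r : List LTerm)
    (hr : ∀ t ∈ r, 1 ≤ t.1 ∧ 1 ≤ t.2.1 ∧ t.1 ≤ n + 1) (x : ℝ) (hx : 1 < x) :
    ∃ d, HasDerivAt (evT g r) d x ∧ x * (x ^ 2 - 1) * d = evT g (stepR n r) x := by
  induction r with
  | nil => exact ⟨0, by simpa [evT] using hasDerivAt_const x (0 : ℝ), by simp [stepR, evT]⟩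
  | cons t s ih =>
    obtain ⟨d1, hd1, e1⟩ := ih (fun u hu => hr u (by simp [hu]))
    obtain ⟨h1, h2, h3⟩ := hr t (by simp)
    obtain ⟨d2, hd2, e2⟩ := ho t.1 t.2.1 h1 h2 h3 x hx
    refine ⟨_, ((pev_hasDerivAt t.2.2 x).mul hd2).add hd1, ?_⟩
    rw [stepR, evT_append, ← e1]
    simp only [stepT, evT, pev, pev_padd, pev_psc, pev_pmq, pev_pmX, pev_pxd]
    push_cast
    linear_combination (pev t.2.2 x) * e2

lemma evT_conR (n : ℕ) (g : ℕ → ℕ → ℝ → ℝ) (hc : ConSys n g) (J : ℕ) (h1 : 1 ≤ J)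
    (h2 : J ≤ n + 1) (x : ℝ) (hx : 1 < x) : evT g (conR n J) x = 0 := by
  have := hc J h1 h2 x hx
  simp only [conR, evT, pev, pev_pmX]
  push_cast
  linear_combination this

def Shape (V : List (ℕ × ℕ)) (r : List LTerm) : Prop := r.map (fun t => (t.1, t.2.1)) = V

lemma shape_normR (V : List (ℕ × ℕ)) (r : List LTerm) : Shape V (normR V r) := by
  simp [Shape, normR, Function.comp_def]

lemma rowsFrom_sound (n : ℕ) (V : List (ℕ × ℕ)) (hV : V.Nodup)
    (hV2 : ∀ v ∈ V, 1 ≤ v.1 ∧ 1 ≤ v.2 ∧ v.1 ≤ n + 1)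
    (g : ℕ → ℕ → ℝ → ℝ) (hz : ∀ J I x, 1 < x → (J, I) ∉ V → g J I x = 0) (ho : OdeSys n g)
    (s : ℕ) (r : List LTerm) (hr : Shape V r) (h0 : ∀ x, 1 < x → evT g r x = 0) :
    ∀ q ∈ rowsFrom n V s r, Shape V q ∧ ∀ x, 1 < x → evT g q x = 0 := by
  induction s generalizing r with
  | zero => simp [rowsFrom]
  | succ s ih =>
    intro q hq
    rw [rowsFrom, List.mem_cons] at hq
    rcases hq with rfl | hq
    · exact ⟨hr, h0⟩
    · refine ih _ (shape_normR V _) ?_ q hq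
      intro x hx
      rw [evT_normR g V hV x (fun J I => hz J I x hx)]
      have hk : ∀ t ∈ r, 1 ≤ t.1 ∧ 1 ≤ t.2.1 ∧ t.1 ≤ n + 1 := by
        intro t ht
        refine hV2 (t.1, t.2.1) ?_
        rw [← hr]
        exact List.mem_map.2 ⟨t, ht, rfl⟩
      obtain ⟨d, hd, e⟩ := evT_stepR n g ho r hk x hx
      have hd0 : HasDerivAt (evT g r) 0 x := by
        refine (hasDerivAt_const x (0 : ℝ)).congr_of_eventuallyEq ?_
        filter_upwards [lt_mem_nhds hx] with y hy using h0 y hy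
      rw [← e, hd.unique hd0, mul_zero]

lemma rowsAll_sound (n : ℕ) (V : List (ℕ × ℕ)) (hV : V.Nodup)
    (hV2 : ∀ v ∈ V, 1 ≤ v.1 ∧ 1 ≤ v.2 ∧ v.1 ≤ n + 1)
    (g : ℕ → ℕ → ℝ → ℝ) (hz : ∀ J I x, 1 < x → (J, I) ∉ V → g J I x = 0) (ho : OdeSys n g)
    (hc : ConSys n g) (sel : List (ℕ × ℕ)) (hs : ∀ q ∈ sel, 1 ≤ q.1 ∧ q.1 ≤ n + 1) :
    ∀ q ∈ rowsAll n V sel, Shape V q ∧ ∀ x, 1 < x → evT g q x = 0 := by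
  induction sel with
  | nil => simp [rowsAll]
  | cons p t ih =>
    intro q hq
    rw [rowsAll, List.mem_append] at hq
    rcases hq with hq | hq
    · refine rowsFrom_sound n V hV hV2 g hz ho _ _ (shape_normR V _) ?_ q hq
      intro x hx
      rw [evT_normR g V hV x (fun J I => hz J I x hx)]
      have := hs p (by simp)
      exact evT_conR n g hc _ this.1 this.2 x hx
    · exact ih (fun u hu => hs u (by simp [hu])) q hq

lemma dotc_eq (c : ℕ) (w : List ℤ) (M : List (List ℤ)) :
    dotc c w M = ∑ k : Fin M.length, w.getD k 0 * (M.getD k []).getD c 0 := by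
  induction M generalizing w with
  | nil => cases w <;> simp [dotc]
  | cons m ms ih =>
    cases w with
    | nil => simp [dotc]
    | cons a ws =>
      rw [dotc, ih]
      simp only [List.length_cons]
      rw [Fin.sum_univ_succ]
      simp

/-- The polynomial of a coefficient list. -/
noncomputable def toP : List ℤ → Polynomial ℤ
  | [] => 0
  | c :: t => Polynomial.C c + Polynomial.X * toP t

lemma toP_aeval (a : List ℤ) (x : ℝ) : Polynomial.aeval x (toP a) = pev a x := by
  induction a with
  | nil => simp [toP, pev]
  | cons c t ih => simp [toP, pev, ih]

lemma toP_eval (a : List ℤ) (x : ℤ) : Polynomial.eval x (toP a) = pevZ a x := by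
  induction a with
  | nil => simp [toP, pevZ]
  | cons c t ih => simp [toP, pevZ, ih]

lemma evT_shape (g : ℕ → ℕ → ℝ → ℝ) (V : List (ℕ × ℕ)) (r : List LTerm) (hr : Shape V r) (x : ℝ) :
    evT g r x = ∑ c : Fin V.length, pev (r.getD c (0, 0, [])).2.2 x * g V[c].1 V[c].2 x := by
  induction r generalizing V with
  | nil => simp only [Shape, List.map_nil] at hr; subst hr; simp [evT]
  | cons t s ih =>
    simp only [Shape, List.map_cons] at hr
    subst hr
    simp only [List.length_cons]
    rw [Fin.sum_univ_succ, evT, ih _ rfl]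
    simp

lemma chk_sound (n e : ℕ) (C : Cert) (h : chk n e C = true)
    (hV : (varsL n e).Nodup) (hV2 : ∀ v ∈ varsL n e, 1 ≤ v.1 ∧ 1 ≤ v.2 ∧ v.1 ≤ n + 1)
    (g : ℕ → ℕ → ℝ → ℝ) (hz : ∀ J I x, 1 < x → (J, I) ∉ varsL n e → g J I x = 0)
    (ho : OdeSys n g) (hc : ConSys n g) :
    ∀ J I x, 1 < x → g J I x = 0 := by
  simp only [chk, Bool.and_eq_true, beq_iff_eq, List.all_eq_true, decide_eq_true_eq,
    List.mem_range] at h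
  obtain ⟨⟨⟨hlen, hs⟩, hp⟩, hm⟩ := h
  generalize varsL n e = V at *
  have hR := rowsAll_sound n V hV hV2 g hz ho hc C.sel hs
  generalize rowsAll n V C.sel = R at *
  let M : Matrix (Fin V.length) (Fin V.length) (Polynomial ℤ) := fun r c =>
    toP ((R.getD r []).getD c (0, 0, [])).2.2
  have hdet : M.det ≠ 0 := by
    intro h0
    have : Fact (1 < C.p) := ⟨hp⟩
    let φ : Polynomial ℤ →+* ZMod C.p := (Int.castRingHom (ZMod C.p)).comp (Polynomial.evalRingHom C.x0)
    let W : Matrix (Fin V.length) (Fin V.length) (ZMod C.p) := fun r c => (((C.W.getD r []).getD c 0 : ℤ) : ZMod C.p)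
    have h1 : W * M.map φ = 1 := by
      ext r c
      have h2 := hm r r.2 c c.2
      rw [dotc_eq] at h2
      have h3 := congrArg (Int.cast : ℤ → ZMod C.p) h2
      rw [ZMod.intCast_mod] at h3
      have hl : (matL R C.x0 C.p).length = V.length := by simp [matL, hlen]
      rw [Matrix.mul_apply, Matrix.one_apply]
      trans (((∑ k : Fin (matL R C.x0 C.p).length, (C.W.getD r []).getD k 0 *
        ((matL R C.x0 C.p).getD k []).getD c 0 : ℤ)) : ZMod C.p)
      · rw [Int.cast_sum]
        refine Fintype.sum_equiv (finCongr hl.symm) _ _ ?_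
        intro k
        rw [Int.cast_mul]
        congr 1
        change ((Polynomial.eval C.x0 (toP ((R.getD k []).getD c (0, 0, [])).2.2) : ℤ) : ZMod C.p)
          = ((((matL R C.x0 C.p).getD k []).getD c 0 : ℤ) : ZMod C.p)
        rw [toP_eval, matL]
        have hk : (k : ℕ) < R.length := by rw [hlen]; exact k.2
        by_cases hc : (c : ℕ) < (R[(k : ℕ)]).length
        · simp [List.getD_eq_getElem?_getD, hk, hc]
        · simp [List.getD_eq_getElem?_getD, hk, List.getElem?_eq_none (not_lt.1 hc), pevZ]
      · rw [h3]; simp [Fin.ext_iff]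
    have h2 := congrArg Matrix.det h1
    rw [Matrix.det_mul, Matrix.det_one] at h2
    have h3 : (M.map φ).det = φ M.det := (RingHom.map_det φ M).symm
    rw [h3, h0, map_zero, mul_zero] at h2
    exact zero_ne_one h2
  have key : ∀ x, 1 < x → Polynomial.aeval x M.det ≠ 0 → ∀ J I, g J I x = 0 := by
    intro x hx hx0 J I
    by_cases hmem : (J, I) ∈ V
    swap
    · exact hz J I x hx hmem
    let A : Matrix (Fin V.length) (Fin V.length) ℝ := M.map (Polynomial.aeval x : Polynomial ℤ →ₐ[ℤ] ℝ)
    have hA : A.det ≠ 0 := by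
      have : A.det = Polynomial.aeval x M.det := by
        rw [AlgHom.map_det]; rfl
      rwa [this]
    have hv := Matrix.eq_zero_of_mulVec_eq_zero (M := A) (v := fun c => g V[c].1 V[c].2 x) hA (by
      ext r
      have hk : (r : ℕ) < R.length := by rw [hlen]; exact r.2
      obtain ⟨hsh, hev⟩ := hR (R[(r : ℕ)]) (List.getElem_mem hk)
      have := hev x hx
      rw [evT_shape g V _ hsh] at this
      rw [Pi.zero_apply, ← this]
      change (∑ c, A r c * g V[c].1 V[c].2 x) = _
      refine Finset.sum_congr rfl fun c _ => ?_
      change Polynomial.aeval x (toP ((R.getD r []).getD c (0, 0, [])).2.2) * _ = _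
      rw [toP_aeval, List.getD_eq_getElem _ _ hk])
    obtain ⟨c, hcl, hcV⟩ := List.getElem_of_mem hmem
    have := congrFun hv ⟨c, hcl⟩
    simpa [hcV] using this
  intro J I x hx
  by_cases hmem : (J, I) ∈ V
  swap
  · exact hz J I x hx hmem
  obtain ⟨a1, a2, a3⟩ := hV2 _ hmem
  have hcont : ContinuousAt (g J I) x := (ho J I a1 a2 a3 x hx).choose_spec.1.continuousAt
  have hfin : {y : ℝ | Polynomial.aeval y M.det = 0}.Finite := by
    have hne : (M.det.map (Int.castRingHom ℝ)) ≠ 0 := by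
      rwa [Ne, Polynomial.map_eq_zero_iff]
      exact Int.cast_injective
    refine (Polynomial.finite_setOfPred_isRoot hne).subset ?_
    intro y hy
    simpa [Polynomial.IsRoot, Polynomial.eval_map, Polynomial.aeval_def] using hy
  have hfr : ∃ᶠ y in nhds x, g J I y = 0 := by
    have h1 : ∀ᶠ y in nhdsWithin x {x}ᶜ, y ∉ ({y : ℝ | Polynomial.aeval y M.det = 0} \ {x}) := by
      apply eventually_nhdsWithin_of_eventually_nhds
      exact (hfin.subset Set.sdiff_subset).isClosed.isOpen_compl.mem_nhds (by simp)
    have h2 : ∀ᶠ y in nhdsWithin x {x}ᶜ, g J I y = 0 := by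
      filter_upwards [h1, eventually_nhdsWithin_of_eventually_nhds (lt_mem_nhds hx), self_mem_nhdsWithin]
        with y hy1 hy2 hy3
      refine key y hy2 ?_ J I
      intro h
      exact hy1 ⟨h, hy3⟩
    exact h2.frequently.filter_mono nhdsWithin_le_nhds
  by_contra hne
  have := hcont.eventually_ne hne
  obtain ⟨y, hy1, hy2⟩ := (hfr.and_eventually this).exists
  exact hy2 hy1


/-- Certificate for order 1, parity 0. -/
def cert10 : Cert := ⟨3, 11,
  [(2, 7)],
  [[3, 2, 4, 4, 9, 4, 0],
   [0, 8, 8, 9, 5, 3, 3],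
   [10, 2, 7, 7, 3, 10, 7],
   [0, 7, 7, 7, 3, 1, 9],
   [7, 2, 4, 4, 9, 4, 0],
   [9, 4, 7, 8, 0, 2, 3],
   [8, 1, 4, 7, 2, 6, 9]]⟩

/-- Certificate for order 1, parity 1. -/
def cert11 : Cert := ⟨2, 11,
  [(1, 6)],
  [[6, 6, 0, 0, 0, 0],
   [7, 3, 3, 6, 0, 0],
   [8, 8, 2, 3, 6, 4],
   [8, 0, 0, 0, 0, 0],
   [7, 2, 5, 0, 0, 0],
   [3, 10, 10, 6, 1, 0]]⟩

/-- Certificate for order 2, parity 0. -/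
def cert20 : Cert := ⟨3, 11,
  [(2, 10)],
  [[4, 7, 6, 8, 8, 3, 1, 8, 9, 8],
   [6, 4, 3, 10, 7, 4, 5, 8, 8, 6],
   [7, 1, 10, 6, 10, 0, 6, 4, 5, 5],
   [7, 2, 7, 2, 2, 8, 8, 0, 0, 7],
   [9, 0, 1, 5, 10, 4, 0, 0, 0, 0],
   [6, 1, 10, 3, 5, 3, 0, 9, 6, 9],
   [8, 9, 8, 8, 0, 2, 6, 1, 2, 10],
   [5, 5, 0, 0, 10, 7, 7, 1, 8, 1],
   [2, 3, 9, 4, 1, 8, 5, 10, 7, 7],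
   [4, 5, 7, 2, 10, 2, 2, 3, 7, 0]]⟩

/-- Certificate for order 2, parity 1. -/
def cert21 : Cert := ⟨3, 11,
  [(1, 4), (3, 4)],
  [[7, 5, 2, 9, 6, 10, 2, 0],
   [0, 10, 10, 7, 8, 4, 5, 4],
   [10, 0, 1, 3, 10, 10, 2, 3],
   [1, 9, 8, 3, 2, 7, 8, 0],
   [8, 5, 5, 8, 1, 6, 7, 5],
   [8, 7, 3, 9, 2, 1, 10, 8],
   [1, 9, 8, 3, 6, 7, 8, 0],
   [3, 6, 1, 1, 6, 10, 3, 5]]⟩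

/-- Certificate for order 3, parity 0. -/
def cert30 : Cert := ⟨3, 11,
  [(2, 6), (4, 6)],
  [[2, 1, 9, 3, 2, 5, 8, 7, 9, 7, 2, 3],
   [3, 1, 9, 1, 8, 10, 0, 3, 7, 8, 4, 5],
   [2, 2, 6, 9, 1, 9, 0, 4, 2, 4, 1, 10],
   [8, 5, 9, 3, 8, 9, 7, 8, 9, 4, 8, 9],
   [4, 4, 1, 0, 0, 4, 6, 9, 6, 2, 6, 0],
   [5, 7, 6, 1, 2, 4, 7, 9, 6, 5, 2, 4],
   [9, 3, 1, 5, 0, 2, 5, 6, 7, 3, 2, 4],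
   [10, 2, 3, 4, 10, 0, 8, 9, 2, 6, 0, 4],
   [10, 9, 2, 5, 6, 9, 9, 9, 0, 6, 0, 9],
   [3, 3, 0, 4, 1, 9, 9, 1, 9, 9, 2, 4],
   [10, 2, 3, 4, 10, 0, 1, 9, 2, 6, 0, 4],
   [5, 0, 1, 7, 0, 10, 3, 4, 8, 4, 7, 0]]⟩

/-- Certificate for order 3, parity 1. -/
def cert31 : Cert := ⟨3, 11,
  [(1, 5), (3, 5)],
  [[4, 9, 7, 7, 10, 2, 5, 5, 3, 10],
   [6, 4, 4, 0, 3, 6, 4, 2, 3, 10],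
   [2, 7, 1, 5, 6, 1, 4, 5, 7, 8],
   [0, 3, 6, 6, 7, 8, 9, 9, 1, 7],
   [1, 4, 2, 6, 2, 9, 5, 3, 8, 5],
   [1, 0, 9, 2, 1, 1, 0, 0, 0, 4],
   [8, 4, 5, 4, 9, 3, 7, 10, 0, 2],
   [5, 3, 7, 8, 7, 8, 10, 6, 7, 2],
   [7, 1, 9, 4, 8, 3, 0, 4, 1, 6],
   [0, 5, 9, 7, 8, 1, 3, 2, 9, 8]]⟩

/-- Certificate for order 4, parity 0. -/
def cert40 : Cert := ⟨3, 11,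
  [(2, 7), (4, 7)],
  [[0, 4, 7, 8, 4, 6, 4, 3, 0, 6, 6, 4, 8, 9],
   [7, 0, 9, 0, 6, 2, 5, 0, 3, 5, 8, 10, 6, 3],
   [1, 7, 4, 1, 2, 3, 1, 6, 9, 0, 5, 7, 10, 2],
   [6, 10, 3, 1, 5, 8, 4, 6, 10, 1, 10, 0, 3, 2],
   [4, 4, 6, 0, 1, 4, 0, 6, 7, 5, 10, 6, 0, 0],
   [3, 0, 4, 10, 10, 6, 1, 0, 0, 4, 8, 10, 9, 1],
   [4, 4, 1, 1, 10, 3, 8, 5, 3, 10, 7, 8, 1, 8],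
   [0, 9, 0, 2, 3, 4, 1, 10, 3, 6, 5, 2, 2, 5],
   [1, 5, 10, 4, 4, 1, 8, 1, 3, 0, 5, 7, 8, 10],
   [5, 7, 6, 8, 2, 6, 5, 8, 0, 5, 2, 3, 5, 3],
   [5, 9, 6, 8, 8, 0, 0, 8, 6, 7, 4, 6, 4, 0],
   [6, 0, 1, 10, 7, 9, 8, 1, 0, 1, 0, 6, 2, 10],
   [5, 2, 6, 4, 2, 3, 9, 6, 0, 6, 5, 2, 0, 1],
   [5, 0, 0, 7, 2, 10, 10, 6, 1, 8, 2, 3, 1, 3]]⟩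

/-- Certificate for order 4, parity 1. -/
def cert41 : Cert := ⟨3, 11,
  [(1, 4), (3, 3), (5, 4)],
  [[5, 2, 4, 9, 9, 7, 0, 10, 3, 0, 0],
   [2, 9, 2, 10, 7, 0, 5, 1, 2, 4, 4],
   [0, 2, 6, 5, 3, 0, 8, 8, 4, 0, 6],
   [4, 8, 5, 3, 3, 6, 0, 7, 1, 0, 0],
   [8, 4, 0, 0, 3, 8, 7, 3, 3, 2, 10],
   [3, 3, 4, 9, 3, 9, 2, 10, 9, 1, 0],
   [1, 0, 9, 1, 3, 2, 10, 10, 10, 4, 8],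
   [7, 4, 0, 0, 4, 4, 7, 6, 9, 7, 10],
   [0, 1, 3, 4, 5, 8, 6, 0, 2, 9, 7],
   [8, 6, 2, 10, 10, 9, 6, 10, 2, 9, 7],
   [0, 1, 3, 4, 5, 8, 6, 4, 2, 9, 7]]⟩

/-- Certificate for order 5, parity 0. -/
def cert50 : Cert := ⟨3, 11,
  [(2, 5), (4, 5), (6, 5)],
  [[10, 2, 3, 5, 7, 6, 6, 4, 8, 6, 3, 0, 0, 1, 2],
   [8, 8, 4, 2, 4, 10, 4, 8, 9, 0, 4, 9, 9, 3, 4],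
   [6, 4, 5, 5, 1, 0, 2, 6, 4, 7, 0, 1, 6, 0, 8],
   [9, 5, 2, 3, 10, 7, 9, 0, 2, 7, 5, 1, 5, 0, 1],
   [6, 4, 7, 6, 9, 6, 0, 4, 1, 6, 9, 8, 2, 7, 7],
   [8, 4, 7, 3, 7, 3, 0, 8, 4, 9, 6, 7, 6, 8, 3],
   [3, 0, 1, 2, 7, 10, 5, 4, 10, 5, 8, 10, 7, 8, 7],
   [3, 10, 6, 6, 3, 7, 6, 1, 10, 7, 10, 5, 4, 4, 5],
   [7, 0, 4, 6, 7, 7, 5, 6, 1, 10, 2, 10, 0, 4, 6],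
   [5, 1, 7, 9, 1, 9, 10, 8, 8, 1, 3, 9, 0, 1, 1],
   [0, 8, 2, 5, 7, 2, 0, 1, 0, 6, 5, 4, 7, 3, 6],
   [8, 6, 6, 5, 7, 0, 6, 2, 10, 6, 2, 7, 3, 6, 1],
   [2, 0, 6, 9, 9, 10, 4, 9, 3, 7, 8, 0, 6, 2, 2],
   [3, 9, 3, 4, 9, 9, 6, 5, 10, 9, 5, 8, 10, 5, 7],
   [2, 0, 6, 9, 9, 10, 4, 9, 3, 7, 1, 0, 6, 2, 2]]⟩

/-- Certificate for order 5, parity 1. -/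
def cert51 : Cert := ⟨3, 11,
  [(1, 4), (3, 4), (5, 4)],
  [[8, 1, 4, 9, 4, 4, 4, 8, 4, 2, 1, 9],
   [0, 8, 10, 2, 2, 2, 2, 1, 2, 1, 9, 2],
   [7, 0, 3, 2, 7, 8, 0, 9, 9, 10, 4, 3],
   [5, 4, 5, 3, 5, 5, 5, 10, 5, 8, 4, 3],
   [3, 9, 6, 1, 7, 5, 3, 9, 9, 7, 3, 1],
   [3, 4, 0, 2, 3, 4, 5, 4, 6, 7, 8, 7],
   [10, 2, 10, 5, 10, 9, 8, 7, 0, 4, 4, 5],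
   [5, 0, 3, 2, 6, 5, 6, 2, 3, 9, 10, 9],
   [5, 7, 5, 9, 7, 0, 6, 0, 10, 3, 6, 9],
   [0, 0, 5, 8, 3, 10, 9, 9, 4, 4, 9, 2],
   [0, 4, 9, 7, 6, 4, 8, 8, 3, 6, 2, 5],
   [3, 3, 8, 0, 9, 1, 10, 2, 3, 0, 3, 5]]⟩

/-- Certificate for order 6, parity 0. -/
def cert60 : Cert := ⟨3, 11,
  [(2, 6), (4, 5), (6, 5)],
  [[4, 4, 10, 9, 8, 5, 2, 0, 5, 4, 5, 7, 9, 6, 4, 9],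
   [8, 5, 6, 7, 8, 4, 4, 5, 1, 9, 0, 3, 1, 3, 1, 7],
   [4, 7, 1, 1, 7, 10, 8, 7, 9, 2, 0, 8, 2, 3, 9, 7],
   [1, 3, 8, 8, 7, 2, 8, 2, 0, 3, 4, 3, 2, 0, 5, 10],
   [9, 9, 6, 4, 3, 4, 10, 4, 6, 4, 6, 10, 3, 7, 4, 0],
   [2, 10, 2, 10, 2, 2, 10, 7, 8, 1, 9, 3, 6, 8, 0, 7],
   [4, 0, 6, 7, 10, 1, 1, 0, 3, 4, 6, 9, 6, 4, 6, 7],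
   [6, 3, 2, 10, 9, 3, 7, 8, 7, 4, 7, 2, 8, 8, 4, 2],
   [10, 6, 7, 4, 1, 9, 5, 2, 6, 9, 7, 2, 0, 4, 0, 7],
   [4, 0, 10, 6, 0, 6, 3, 4, 5, 9, 9, 9, 0, 1, 3, 2],
   [8, 2, 3, 1, 0, 8, 0, 3, 1, 6, 4, 3, 10, 3, 1, 6],
   [6, 5, 6, 1, 2, 10, 3, 1, 4, 4, 0, 5, 3, 0, 4, 4],
   [6, 1, 6, 5, 8, 7, 1, 4, 6, 1, 9, 6, 0, 4, 7, 9],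
   [1, 3, 5, 9, 7, 4, 4, 7, 6, 8, 7, 4, 7, 0, 4, 4],
   [6, 8, 8, 4, 10, 1, 5, 10, 5, 7, 1, 6, 2, 6, 5, 6],
   [7, 4, 1, 7, 7, 6, 2, 5, 10, 7, 7, 8, 5, 6, 5, 3]]⟩

/-- Certificate for order 6, parity 1. -/
def cert61 : Cert := ⟨3, 11,
  [(1, 3), (3, 3), (5, 3), (7, 3)],
  [[4, 0, 0, 2, 0, 0, 7, 8, 0, 3, 1, 4],
   [4, 2, 0, 1, 10, 0, 7, 6, 9, 7, 6, 7],
   [9, 9, 5, 2, 5, 8, 7, 4, 2, 7, 2, 4],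
   [0, 0, 0, 8, 0, 0, 6, 10, 0, 1, 4, 5],
   [3, 0, 0, 7, 7, 0, 3, 4, 3, 10, 1, 7],
   [3, 7, 0, 1, 2, 10, 9, 3, 2, 4, 8, 0],
   [0, 0, 0, 0, 0, 0, 7, 6, 0, 8, 7, 3],
   [8, 0, 0, 4, 4, 0, 10, 5, 4, 8, 1, 3],
   [0, 0, 0, 0, 0, 0, 6, 0, 0, 4, 1, 0],
   [0, 0, 0, 0, 0, 0, 0, 0, 0, 1, 4, 4],
   [0, 0, 0, 0, 0, 0, 0, 0, 0, 7, 3, 0],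
   [0, 0, 0, 0, 0, 0, 0, 0, 0, 7, 0, 0]]⟩


theorem chk10 : chk 1 0 cert10 = true := by decide +kernel

theorem chk11 : chk 1 1 cert11 = true := by decide +kernel

theorem chk20 : chk 2 0 cert20 = true := by decide +kernel

theorem chk21 : chk 2 1 cert21 = true := by decide +kernel

theorem chk30 : chk 3 0 cert30 = true := by decide +kernel

theorem chk31 : chk 3 1 cert31 = true := by decide +kernel

theorem chk40 : chk 4 0 cert40 = true := by decide +kernel

theorem chk41 : chk 4 1 cert41 = true := by decide +kernel

theorem chk50 : chk 5 0 cert50 = true := by decide +kernel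

theorem chk51 : chk 5 1 cert51 = true := by decide +kernel

theorem chk60 : chk 6 0 cert60 = true := by decide +kernel

theorem chk61 : chk 6 1 cert61 = true := by decide +kernel


lemma mem_varsL (n e J I : ℕ) :
    (J, I) ∈ varsL n e ↔ 1 ≤ J ∧ J ≤ n + 1 ∧ 1 ≤ I ∧ I + J ≤ 8 ∧ (I + J) % 2 = e := by
  simp only [varsL, List.mem_flatMap, List.mem_map, List.mem_filter, List.mem_range'_1, beq_iff_eq,
    Prod.mk.injEq]
  constructor
  · rintro ⟨J', h1, I', h2, rfl, rfl⟩
    omega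
  · rintro h
    exact ⟨J, by omega, I, by omega, rfl, rfl⟩

lemma chk_sound2 (n e : ℕ) (C : Cert) (h : chk n e C = true) (hV : (varsL n e).Nodup)
    (g : ℕ → ℕ → ℝ → ℝ)
    (hz : ∀ J I x, 1 < x → (J = 0 ∨ n + 1 < J ∨ I = 0 ∨ 8 < I + J) → g J I x = 0)
    (ho : OdeSys n g) (hc : ConSys n g) :
    ∀ J I x, 1 < x → (I + J) % 2 = e → g J I x = 0 := by
  let g' : ℕ → ℕ → ℝ → ℝ := fun J I => if (I + J) % 2 = e then g J I else 0
  have hg1 : ∀ J I, (I + J) % 2 = e → g' J I = g J I := fun J I h => if_pos h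
  have hg0 : ∀ J I, ¬ (I + J) % 2 = e → g' J I = 0 := fun J I h => if_neg h
  have key : ∀ J I x, 1 < x → g' J I x = 0 := by
    refine chk_sound n e C h hV ?_ g' ?_ ?_ ?_
    · rintro ⟨J, I⟩ hv
      rw [mem_varsL] at hv
      exact ⟨hv.1, hv.2.2.1, hv.2.1⟩
    · intro J I x hx hm
      rw [mem_varsL] at hm
      by_cases he : (I + J) % 2 = e
      · rw [hg1 J I he]
        exact hz J I x hx (by omega)
      · rw [hg0 J I he]; rfl
    · intro J I hJ hI hJn x hx
      by_cases he : (I + J) % 2 = e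
      · rw [hg1 J I he, hg1 J (I + 2) (by omega), hg1 (J - 1) (I + 1) (by omega),
          hg1 (J + 1) (I - 1) (by omega), hg1 (J + 1) (I + 1) (by omega)]
        exact ho J I hJ hI hJn x hx
      · rw [hg0 J I he, hg0 J (I + 2) (by omega), hg0 (J - 1) (I + 1) (by omega),
          hg0 (J + 1) (I - 1) (by omega), hg0 (J + 1) (I + 1) (by omega)]
        exact ⟨0, hasDerivAt_const x 0, by simp⟩
    · intro J hJ hJn x hx
      by_cases he : (2 + J) % 2 = e
      · rw [hg1 J 2 he, hg1 (J - 1) 1 (by omega), hg1 (J + 1) 1 (by omega)]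
        exact hc J hJ hJn x hx
      · rw [hg0 J 2 he, hg0 (J - 1) 1 (by omega), hg0 (J + 1) 1 (by omega)]
        simp
  intro J I x hx he
  rw [← hg1 J I he]
  exact key J I x hx

theorem partC (n : ℕ) (h1 : 1 ≤ n) (h6 : n ≤ 6) (g : ℕ → ℕ → ℝ → ℝ)
    (hz : ∀ J I x, 1 < x → (J = 0 ∨ n + 1 < J ∨ I = 0 ∨ 8 < I + J) → g J I x = 0)
    (ho : OdeSys n g) (hc : ConSys n g) :
    ∀ J I x, 1 < x → g J I x = 0 := by
  have key : (∀ J I x, 1 < x → (I + J) % 2 = 0 → g J I x = 0) ∧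
      (∀ J I x, 1 < x → (I + J) % 2 = 1 → g J I x = 0) := by
    interval_cases n
    · exact ⟨chk_sound2 1 0 cert10 chk10 (by decide) g hz ho hc,
        chk_sound2 1 1 cert11 chk11 (by decide) g hz ho hc⟩
    · exact ⟨chk_sound2 2 0 cert20 chk20 (by decide) g hz ho hc,
        chk_sound2 2 1 cert21 chk21 (by decide) g hz ho hc⟩
    · exact ⟨chk_sound2 3 0 cert30 chk30 (by decide) g hz ho hc,
        chk_sound2 3 1 cert31 chk31 (by decide) g hz ho hc⟩
    · exact ⟨chk_sound2 4 0 cert40 chk40 (by decide) g hz ho hc,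
        chk_sound2 4 1 cert41 chk41 (by decide) g hz ho hc⟩
    · exact ⟨chk_sound2 5 0 cert50 chk50 (by decide) g hz ho hc,
        chk_sound2 5 1 cert51 chk51 (by decide) g hz ho hc⟩
    · exact ⟨chk_sound2 6 0 cert60 chk60 (by decide) g hz ho hc,
        chk_sound2 6 1 cert61 chk61 (by decide) g hz ho hc⟩
  intro J I x hx
  rcases Nat.mod_two_eq_zero_or_one (I + J) with h | h
  · exact key.1 J I x hx h
  · exact key.2 J I x hx h


/-! ### Part B: calculus at the equatorial plane -/

/-- The reduced base domain in `(x, y)`. -/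
def Om : Set (ℝ × ℝ) := {b | 1 < b.1 ∧ -1 < b.2 ∧ b.2 < 1}

lemma isOpen_Om : IsOpen Om := by
  have h1 : IsOpen {b : ℝ × ℝ | 1 < b.1} := isOpen_lt continuous_const continuous_fst
  have h2 : IsOpen {b : ℝ × ℝ | -1 < b.2} := isOpen_lt continuous_const continuous_snd
  have h3 : IsOpen {b : ℝ × ℝ | b.2 < 1} := isOpen_lt continuous_snd continuous_const
  exact h1.inter (h2.inter h3)

lemma mem_Om0 {x : ℝ} (hx : 1 < x) : (x, (0 : ℝ)) ∈ Om := ⟨hx, by norm_num, by norm_num⟩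

/-- Smoothness on the reduced domain. -/
def Sm (f : ℝ × ℝ → ℝ) : Prop := ContDiffOn ℝ (⊤ : ℕ∞) f Om

def dx (f : ℝ × ℝ → ℝ) (b : ℝ × ℝ) : ℝ := fderiv ℝ f b (1, 0)
def dy (f : ℝ × ℝ → ℝ) (b : ℝ × ℝ) : ℝ := fderiv ℝ f b (0, 1)

lemma Sm.add {f g : ℝ × ℝ → ℝ} (hf : Sm f) (hg : Sm g) : Sm (fun b => f b + g b) := ContDiffOn.add hf hg
lemma Sm.mul {f g : ℝ × ℝ → ℝ} (hf : Sm f) (hg : Sm g) : Sm (fun b => f b * g b) := ContDiffOn.mul hf hg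
lemma Sm.smul {f : ℝ × ℝ → ℝ} (hf : Sm f) (c : ℝ) : Sm (fun b => c * f b) := 
  ContDiffOn.mul contDiffOn_const hf
lemma Sm.zero : Sm 0 := contDiffOn_const

lemma Sm.diffAt {f : ℝ × ℝ → ℝ} (hf : Sm f) {b : ℝ × ℝ} (hb : b ∈ Om) : DifferentiableAt ℝ f b :=
  (ContDiffOn.contDiffAt hf (isOpen_Om.mem_nhds hb)).differentiableAt (by simp)

lemma Sm.dirder {f : ℝ × ℝ → ℝ} (hf : Sm f) (v : ℝ × ℝ) : Sm (fun b => fderiv ℝ f b v) := by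
  have h : ContDiffOn ℝ (⊤ : ℕ∞) (fderiv ℝ f) Om :=
    ContDiffOn.fderiv_of_isOpen hf isOpen_Om (by simp)
  exact h.clm_apply contDiffOn_const

lemma Sm.dx {f : ℝ × ℝ → ℝ} (hf : Sm f) : Sm (dx f) := hf.dirder _
lemma Sm.dy {f : ℝ × ℝ → ℝ} (hf : Sm f) : Sm (dy f) := hf.dirder _

lemma fderiv_congr_Om {f g : ℝ × ℝ → ℝ} (h : Set.EqOn f g Om) {b : ℝ × ℝ} (hb : b ∈ Om) :
    fderiv ℝ f b = fderiv ℝ g b :=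
  Filter.EventuallyEq.fderiv_eq (Filter.mem_of_superset (isOpen_Om.mem_nhds hb) h)

lemma dy_congr {f g : ℝ × ℝ → ℝ} (h : Set.EqOn f g Om) : Set.EqOn (dy f) (dy g) Om :=
  fun b hb => by simp only [dy, fderiv_congr_Om h hb]

lemma dx_congr {f g : ℝ × ℝ → ℝ} (h : Set.EqOn f g Om) : Set.EqOn (dx f) (dx g) Om :=
  fun b hb => by simp only [dx, fderiv_congr_Om h hb]

lemma dy_add {f g : ℝ × ℝ → ℝ} (hf : Sm f) (hg : Sm g) :
    Set.EqOn (dy (fun b => f b + g b)) (fun b => dy f b + dy g b) Om := by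
  intro b hb
  have := fderiv_add (hf.diffAt hb) (hg.diffAt hb)
  change fderiv ℝ (f + g) b (0, 1) = _
  rw [this]; rfl

lemma dy_mul {f g : ℝ × ℝ → ℝ} (hf : Sm f) (hg : Sm g) :
    Set.EqOn (dy (fun b => f b * g b)) (fun b => dy f b * g b + f b * dy g b) Om := by
  intro b hb
  have := fderiv_mul (hf.diffAt hb) (hg.diffAt hb)
  change fderiv ℝ (f * g) b (0, 1) = _
  rw [this]
  simp [dy]; ring

lemma dxdy_comm {f : ℝ × ℝ → ℝ} (hf : Sm f) : Set.EqOn (dx (dy f)) (dy (dx f)) Om := by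
  intro b hb
  have hc : ContDiffAt ℝ (⊤ : ℕ∞) f b := ContDiffOn.contDiffAt hf (isOpen_Om.mem_nhds hb)
  have hs : IsSymmSndFDerivAt ℝ f b := hc.isSymmSndFDerivAt (by simp; exact WithTop.coe_le_coe.2 le_top)
  have h : ContDiffOn ℝ (⊤ : ℕ∞) (fderiv ℝ f) Om :=
    ContDiffOn.fderiv_of_isOpen hf isOpen_Om (by simp)
  have hd : DifferentiableAt ℝ (fderiv ℝ f) b :=
    (h.contDiffAt (isOpen_Om.mem_nhds hb)).differentiableAt (by simp)
  have e : ∀ v w : ℝ × ℝ, fderiv ℝ (fun c => fderiv ℝ f c v) b w = fderiv ℝ (fderiv ℝ f) b w v := by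
    intro v w
    rw [fderiv_clm_apply hd (differentiableAt_const v)]
    simp
  change fderiv ℝ (fun c => fderiv ℝ f c (0, 1)) b (1, 0) = fderiv ℝ (fun c => fderiv ℝ f c (1, 0)) b (0, 1)
  rw [e, e]
  exact hs _ _

/-- Iterated `y`-derivative. -/
def Dy (l : ℕ) (f : ℝ × ℝ → ℝ) : ℝ × ℝ → ℝ := dy^[l] f

lemma Dy_zero (f : ℝ × ℝ → ℝ) : Dy 0 f = f := rfl
lemma Dy_succ (l : ℕ) (f : ℝ × ℝ → ℝ) : Dy (l + 1) f = Dy l (dy f) := rfl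
lemma Dy_succ' (l : ℕ) (f : ℝ × ℝ → ℝ) : Dy (l + 1) f = dy (Dy l f) :=
  Function.iterate_succ_apply' dy l f

lemma Sm.Dy {f : ℝ × ℝ → ℝ} (hf : Sm f) (l : ℕ) : Sm (Dy l f) := by
  induction l generalizing f with
  | zero => exact hf
  | succ l ih => exact ih hf.dy

lemma Dy_congr {f g : ℝ × ℝ → ℝ} (l : ℕ) (h : Set.EqOn f g Om) : Set.EqOn (Dy l f) (Dy l g) Om := by
  induction l generalizing f g with
  | zero => exact h
  | succ l ih => exact ih (dy_congr h)

lemma Dy_fun_zero (l : ℕ) : Dy l 0 = 0 := by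
  induction l with
  | zero => rfl
  | succ l ih =>
    rw [Dy_succ', ih]
    ext b
    change fderiv ℝ (fun _ => (0 : ℝ)) b (0, 1) = 0
    simp

lemma Dy_add {f g : ℝ × ℝ → ℝ} (hf : Sm f) (hg : Sm g) (l : ℕ) :
    Set.EqOn (Dy l (fun b => f b + g b)) (fun b => Dy l f b + Dy l g b) Om := by
  induction l generalizing f g with
  | zero => exact fun b _ => rfl
  | succ l ih =>
    intro b hb
    rw [Dy_succ, Dy_congr l (dy_add hf hg) hb]
    exact ih hf.dy hg.dy hb

lemma Dy_dx {f : ℝ × ℝ → ℝ} (hf : Sm f) (l : ℕ) : Set.EqOn (Dy l (dx f)) (dx (Dy l f)) Om := by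
  induction l generalizing f with
  | zero => exact fun b _ => rfl
  | succ l ih =>
    intro b hb
    rw [Dy_succ, Dy_succ, ← ih hf.dy hb]
    exact Dy_congr l (fun c hc => (dxdy_comm hf hc).symm) hb

/-- Vanishing to order `l` at the equatorial plane. -/
def Van (l : ℕ) (f : ℝ × ℝ → ℝ) : Prop := ∀ s, s < l → ∀ x, 1 < x → Dy s f (x, 0) = 0

lemma Van.mono {l l' : ℕ} {f : ℝ × ℝ → ℝ} (h : Van l f) (hl : l' ≤ l) : Van l' f :=
  fun s hs => h s (lt_of_lt_of_le hs hl)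

lemma Van.dy {l : ℕ} {f : ℝ × ℝ → ℝ} (h : Van (l + 1) f) : Van l (dy f) :=
  fun s hs x hx => h (s + 1) (by omega) x hx

lemma hasDerivAt_line {f : ℝ × ℝ → ℝ} (hf : Sm f) {x : ℝ} (hx : 1 < x) :
    HasDerivAt (fun t => f (t, 0)) (dx f (x, 0)) x := by
  have h1 := (hf.diffAt (mem_Om0 hx)).hasFDerivAt
  have h2 : HasDerivAt (fun t : ℝ => (t, (0 : ℝ))) (1, 0) x :=
    (hasDerivAt_id x).prodMk (hasDerivAt_const x (0 : ℝ))
  exact h1.comp_hasDerivAt x h2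

lemma dx_zero_of_line {f : ℝ × ℝ → ℝ} (hf : Sm f) (h0 : ∀ x, 1 < x → f (x, 0) = 0) {x : ℝ}
    (hx : 1 < x) : dx f (x, 0) = 0 := by
  refine (hasDerivAt_line hf hx).unique ?_
  refine (hasDerivAt_const x (0 : ℝ)).congr_of_eventuallyEq ?_
  filter_upwards [lt_mem_nhds hx] with y hy using h0 y hy

lemma Van.dx {l : ℕ} {f : ℝ × ℝ → ℝ} (hf : Sm f) (h : Van l f) : Van l (dx f) := by
  intro s hs x hx
  rw [Dy_dx hf s (mem_Om0 hx)]
  exact dx_zero_of_line (hf.Dy s) (h s hs) hx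

lemma Dy_mul_van {A f : ℝ × ℝ → ℝ} (hA : Sm A) (hf : Sm f) (l : ℕ) (h : Van l f) {x : ℝ}
    (hx : 1 < x) : Dy l (fun b => A b * f b) (x, 0) = A (x, 0) * Dy l f (x, 0) := by
  induction l generalizing A f with
  | zero => rfl
  | succ l ih =>
    rw [Dy_succ, Dy_congr l (dy_mul hA hf) (mem_Om0 hx),
      Dy_add (hA.dy.mul hf) (hA.mul hf.dy) l (mem_Om0 hx)]
    change Dy l (fun b => dy A b * f b) (x, 0) + Dy l (fun b => A b * dy f b) (x, 0) = _
    rw [ih hA.dy hf (h.mono (by omega)), ih hA hf.dy h.dy, h l (by omega) x hx, Dy_succ]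
    ring

lemma Dy_mul_van_zero {A f : ℝ × ℝ → ℝ} (hA : Sm A) (hf : Sm f) (l : ℕ) (h : Van l f)  {x : ℝ}
    (hx : 1 < x) (h0 : A (x, 0) = 0) :
    Dy (l + 1) (fun b => A b * f b) (x, 0) = (l + 1) * dy A (x, 0) * Dy l f (x, 0) := by
  induction l generalizing f with
  | zero =>
    rw [Dy_succ, Dy_congr 0 (dy_mul hA hf) (mem_Om0 hx)]
    simp [Dy_zero, h0]
  | succ l ih =>
    rw [Dy_succ, Dy_congr _ (dy_mul hA hf) (mem_Om0 hx),
      Dy_add (hA.dy.mul hf) (hA.mul hf.dy) _ (mem_Om0 hx)]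
    change Dy (l + 1) (fun b => dy A b * f b) (x, 0) + Dy (l + 1) (fun b => A b * dy f b) (x, 0) = _
    rw [Dy_mul_van hA.dy hf _ h hx, ih hf.dy h.dy, Dy_succ]
    push_cast
    ring

lemma Dy_mul_van_zero' {A f : ℝ × ℝ → ℝ} (hA : Sm A) (hf : Sm f) (l : ℕ) (h : Van (l - 1) f)  {x : ℝ}
    (hx : 1 < x) (h0 : A (x, 0) = 0) :
    Dy l (fun b => A b * f b) (x, 0) = l * dy A (x, 0) * Dy (l - 1) f (x, 0) := by
  cases l with
  | zero => simp [Dy_zero, h0]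
  | succ l =>
    rw [Dy_mul_van_zero hA hf l h hx h0]
    simp


def cA0 (b : ℝ × ℝ) : ℝ := -2 * ((1 - b.2 ^ 2) ^ 2 * (b.1 ^ 2 - 1) ^ 2 * (b.1 ^ 2 - b.2 ^ 2) ^ 3)
def cA1 (s : ℝ) (b : ℝ × ℝ) : ℝ := s * ((1 - b.2 ^ 2) ^ 2 * (b.1 ^ 2 - 1) * (b.1 ^ 2 - b.2 ^ 2) ^ 2
  * (6 * b.1 * (b.1 ^ 2 - 1) - (b.1 ^ 2 - b.2 ^ 2) * (6 * b.1 - 4)))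
def cA2 (s : ℝ) (b : ℝ × ℝ) : ℝ := s * ((1 - b.2 ^ 2) ^ 3 * (b.1 ^ 2 - b.2 ^ 2) ^ 2
  * (6 * b.1 * (b.1 ^ 2 - 1) - (b.1 ^ 2 - b.2 ^ 2) * (8 * b.1 - 4)))
def cA3 (s : ℝ) (b : ℝ × ℝ) : ℝ := s * ((1 - b.2 ^ 2) * (b.1 ^ 2 - 1) ^ 3 * (4 - 2 * b.1))
def cA4 (s : ℝ) (b : ℝ × ℝ) : ℝ := s * (4 * (1 - b.2 ^ 2) ^ 2 * (b.1 + 1) ^ 8)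
def cA5 (s : ℝ) (b : ℝ × ℝ) : ℝ := s * (-6 * b.2 * (1 - b.2 ^ 2) ^ 2 * (b.1 ^ 2 - 1) ^ 2
  * (b.1 ^ 2 - b.2 ^ 2) ^ 2)
def cA6 (s : ℝ) (b : ℝ × ℝ) : ℝ := s * ((1 - b.2 ^ 2) ^ 2 * (b.1 ^ 2 - 1)
  * (-2 * b.2 * (b.1 ^ 2 - b.2 ^ 2) ^ 3 - 6 * b.2 * (1 - b.2 ^ 2) * (b.1 ^ 2 - b.2 ^ 2) ^ 2))
def cA7 (s : ℝ) (b : ℝ × ℝ) : ℝ := s * (2 * b.2 * (b.1 ^ 2 - 1) ^ 4)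
def cA8 (b : ℝ × ℝ) : ℝ := -2 * ((1 - b.2 ^ 2) ^ 3 * (b.1 ^ 2 - 1) * (b.1 ^ 2 - b.2 ^ 2) ^ 3)

lemma sm_cA0 : Sm cA0 := by unfold Sm cA0; fun_prop
lemma sm_cA1 (s : ℝ) : Sm (cA1 s) := by unfold Sm cA1; fun_prop
lemma sm_cA2 (s : ℝ) : Sm (cA2 s) := by unfold Sm cA2; fun_prop
lemma sm_cA3 (s : ℝ) : Sm (cA3 s) := by unfold Sm cA3; fun_prop
lemma sm_cA4 (s : ℝ) : Sm (cA4 s) := by unfold Sm cA4; fun_prop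
lemma sm_cA5 (s : ℝ) : Sm (cA5 s) := by unfold Sm cA5; fun_prop
lemma sm_cA6 (s : ℝ) : Sm (cA6 s) := by unfold Sm cA6; fun_prop
lemma sm_cA7 (s : ℝ) : Sm (cA7 s) := by unfold Sm cA7; fun_prop
lemma sm_cA8 : Sm cA8 := by unfold Sm cA8; fun_prop

lemma dy_of_line {f : ℝ × ℝ → ℝ} (hf : Sm f) {x : ℝ} (hx : 1 < x) {d : ℝ}
    (h : HasDerivAt (fun t => f (x, t)) d 0) : dy f (x, 0) = d := by
  have h1 := (hf.diffAt (mem_Om0 hx)).hasFDerivAt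
  have h2 : HasDerivAt (fun t : ℝ => (x, t)) (0, 1) 0 :=
    (hasDerivAt_const 0 x).prodMk (hasDerivAt_id (0 : ℝ))
  exact (h1.comp_hasDerivAt (0 : ℝ) h2).unique h

lemma dy_line_mul {f h : ℝ × ℝ → ℝ} (hh : Sm h) (hf : Sm f) (e : ∀ b, f b = b.2 * h b) {x : ℝ} (hx : 1 < x) :
    dy f (x, 0) = h (x, 0) := by
  refine dy_of_line hf hx ?_
  have h1 := (hh.diffAt (mem_Om0 hx)).hasFDerivAt
  have h2 : HasDerivAt (fun t : ℝ => (x, t)) (0, 1) 0 :=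
    (hasDerivAt_const 0 x).prodMk (hasDerivAt_id (0 : ℝ))
  have h3 := (hasDerivAt_id (0 : ℝ)).mul (h1.comp_hasDerivAt (0 : ℝ) h2)
  have h4 : (fun t => f (x, t)) = (id * (h ∘ fun t : ℝ => (x, t))) := by
    ext t; simp [e]
  rw [h4]
  simpa using h3

lemma dy_cA5 (s : ℝ) {x : ℝ} (hx : 1 < x) : dy (cA5 s) (x, 0) = s * (-6 * (x ^ 2 - 1) ^ 2 * x ^ 4) := by
  rw [dy_line_mul (h := fun b => s * (-6 * (1 - b.2 ^ 2) ^ 2 * (b.1 ^ 2 - 1) ^ 2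
    * (b.1 ^ 2 - b.2 ^ 2) ^ 2)) (by unfold Sm; fun_prop) (sm_cA5 s) (fun b => by unfold cA5; ring) hx]
  change s * (-6 * (1 - (0 : ℝ) ^ 2) ^ 2 * (x ^ 2 - 1) ^ 2 * (x ^ 2 - (0 : ℝ) ^ 2) ^ 2) = _
  ring

lemma dy_cA7 (s : ℝ) {x : ℝ} (hx : 1 < x) : dy (cA7 s) (x, 0) = s * (2 * (x ^ 2 - 1) ^ 4) := by
  rw [dy_line_mul (h := fun b => s * (2 * (b.1 ^ 2 - 1) ^ 4)) (by unfold Sm; fun_prop)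
    (sm_cA7 s) (fun b => by unfold cA7; ring) hx]

/-- Coefficient families of polynomial integrals. -/
structure PInt (C : ℤ → ℤ → ℤ → ℤ → ℝ × ℝ → ℝ) : Prop where
  sm : ∀ i j k m, Sm (C i j k m)
  neg : ∀ i j k m, (i < 0 ∨ j < 0 ∨ k < 0 ∨ m < 0 ∨ 6 < i + j + k + m) → C i j k m = 0
  rel : ∀ i j k m : ℤ, ∀ b ∈ Om,
    cA1 (i - 1) b * C (i - 1) j k m b + (cA2 (i + 1) b * C (i + 1) (j - 2) k m b
    + (cA3 (i + 1) b * C (i + 1) j (k - 2) m b + (cA4 (i + 1) b * C (i + 1) j k (m - 2) b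
    + (cA0 b * dx (C (i - 1) j k m) b + (cA5 (j + 1) b * C (i - 2) (j + 1) k m b
    + (cA6 (j - 1) b * C i (j - 1) k m b + (cA7 (j + 1) b * C i (j + 1) (k - 2) m b
    + cA8 b * dy (C i (j - 1) k m) b))))))) = 0

lemma PInt.eqn {C : ℤ → ℤ → ℤ → ℤ → ℝ × ℝ → ℝ} (hC : PInt C) (n : ℕ) (m : ℤ)
    (hV : ∀ i j k m, ∀ s : ℕ, (s : ℤ) + j < n → ∀ x, 1 < x → Dy s (C i j k m) (x, 0) = 0)
    (hm : ∀ i j k, ∀ s : ℕ, (s : ℤ) + j ≤ n → ∀ x, 1 < x → Dy s (C i j k (m - 2)) (x, 0) = 0)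
    (i j k : ℤ) (l : ℕ) (hl : (l : ℤ) + j = n) (x : ℝ) (hx : 1 < x) :
    (i - 1) * (2 * (x ^ 2 - 1) * x ^ 5 * (2 * x - 3)) * Dy l (C (i - 1) j k m) (x, 0)
    - (i + 1) * (2 * (x ^ 2 - 1) ^ 3 * (x - 2)) * Dy l (C (i + 1) j (k - 2) m) (x, 0)
    - 2 * (x ^ 2 - 1) ^ 2 * x ^ 6 * dx (Dy l (C (i - 1) j k m)) (x, 0)
    - l * (j + 1) * (6 * (x ^ 2 - 1) ^ 2 * x ^ 4) * Dy (l - 1) (C (i - 2) (j + 1) k m) (x, 0)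
    + l * (j + 1) * (2 * (x ^ 2 - 1) ^ 4) * Dy (l - 1) (C i (j + 1) (k - 2) m) (x, 0)
    - 2 * (x ^ 2 - 1) * x ^ 6 * Dy (l + 1) (C i (j - 1) k m) (x, 0) = 0 := by
  have hb := mem_Om0 hx
  have s1 := (sm_cA1 (i - 1)).mul (hC.sm (i - 1) j k m)
  have s2 := (sm_cA2 (i + 1)).mul (hC.sm (i + 1) (j - 2) k m)
  have s3 := (sm_cA3 (i + 1)).mul (hC.sm (i + 1) j (k - 2) m)
  have s4 := (sm_cA4 (i + 1)).mul (hC.sm (i + 1) j k (m - 2))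
  have s5 := sm_cA0.mul (hC.sm (i - 1) j k m).dx
  have s6 := (sm_cA5 (j + 1)).mul (hC.sm (i - 2) (j + 1) k m)
  have s7 := (sm_cA6 (j - 1)).mul (hC.sm i (j - 1) k m)
  have s8 := (sm_cA7 (j + 1)).mul (hC.sm i (j + 1) (k - 2) m)
  have s9 := sm_cA8.mul (hC.sm i (j - 1) k m).dy
  have t8 := s8.add s9
  have t7 := s7.add t8
  have t6 := s6.add t7
  have t5 := s5.add t6
  have t4 := s4.add t5
  have t3 := s3.add t4
  have t2 := s2.add t3
  have h0 : Dy l _ (x, 0) = Dy l 0 (x, 0) :=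
    Dy_congr l (fun b hb => (hC.rel i j k m b hb : _ = (0 : ℝ × ℝ → ℝ) b)) hb
  rw [Dy_fun_zero, Dy_add s1 t2 l hb] at h0
  beta_reduce at h0
  rw [Dy_add s2 t3 l hb] at h0
  beta_reduce at h0
  rw [Dy_add s3 t4 l hb] at h0
  beta_reduce at h0
  rw [Dy_add s4 t5 l hb] at h0
  beta_reduce at h0
  rw [Dy_add s5 t6 l hb] at h0
  beta_reduce at h0
  rw [Dy_add s6 t7 l hb] at h0
  beta_reduce at h0
  rw [Dy_add s7 t8 l hb] at h0
  beta_reduce at h0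
  rw [Dy_add s8 s9 l hb] at h0
  beta_reduce at h0
  have v : ∀ i' j' k' m' : ℤ, ∀ l' : ℕ, (l' : ℤ) + j' ≤ n → Van l' (C i' j' k' m') :=
    fun i' j' k' m' l' h s hs x hx => hV i' j' k' m' s (by omega) x hx
  have z5 : cA5 (j + 1) (x, 0) = 0 := by simp [cA5]
  have z7 : cA7 (j + 1) (x, 0) = 0 := by simp [cA7]
  have v8 : Van l (dy (C i (j - 1) k m)) := (v i (j - 1) k m (l + 1) (by push_cast; omega)).dy
  have w : ∀ i' k' : ℤ, Van (l - 1) (C i' (j + 1) k' m) := by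
    intro i' k'
    rcases Nat.eq_zero_or_pos l with h | h
    · subst h; intro s hs; exact absurd hs (by omega)
    · exact v _ _ _ _ _ (by omega)
  rw [Dy_mul_van (sm_cA1 _) (hC.sm _ _ _ _) l (v _ _ _ _ _ (by omega)) hx,
    Dy_mul_van (sm_cA2 _) (hC.sm _ _ _ _) l (v _ _ _ _ _ (by omega)) hx,
    Dy_mul_van (sm_cA3 _) (hC.sm _ _ _ _) l (v _ _ _ _ _ (by omega)) hx,
    Dy_mul_van (sm_cA4 _) (hC.sm _ _ _ _) l (v _ _ _ _ _ (by omega)) hx,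
    Dy_mul_van sm_cA0 (hC.sm _ _ _ _).dx l (Van.dx (hC.sm _ _ _ _) (v _ _ _ _ _ (by omega))) hx,
    Dy_mul_van (sm_cA6 _) (hC.sm _ _ _ _) l (v _ _ _ _ _ (by omega)) hx,
    Dy_mul_van sm_cA8 (hC.sm _ _ _ _).dy l v8 hx,
    Dy_mul_van_zero' (sm_cA5 _) (hC.sm _ _ _ _) l (w _ _) hx z5,
    Dy_mul_van_zero' (sm_cA7 _) (hC.sm _ _ _ _) l (w _ _) hx z7,
    dy_cA5 _ hx, dy_cA7 _ hx, Dy_dx (hC.sm _ _ _ _) l hb, ← Dy_succ,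
    hm _ _ _ l (by omega) x hx, hV (i + 1) (j - 2) k m l (by omega) x hx,
    hV i (j - 1) k m l (by omega) x hx] at h0
  simp only [cA1, cA3, cA0, cA8, Pi.zero_apply] at h0
  linear_combination h0


/-- Scaling factor. -/
def Phi (p q : ℤ) (x : ℝ) : ℝ := (x ^ 2 - 1) ^ p * x ^ (-q)

lemma Phi_add (p q a b : ℤ) {x : ℝ} (hx : 1 < x) :
    Phi (p + a) (q + b) x = Phi p q x * Phi a b x := by
  have h1 : x ^ 2 - 1 ≠ 0 := by nlinarith
  have h2 : x ≠ 0 := by linarith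
  unfold Phi
  rw [zpow_add₀ h1, neg_add, zpow_add₀ h2]
  ring

lemma Phi_deriv (p q : ℤ) {x : ℝ} (hx : 1 < x) :
    HasDerivAt (Phi p q) (Phi p q x * (2 * p * x / (x ^ 2 - 1) - q / x)) x := by
  have h1 : x ^ 2 - 1 ≠ 0 := by nlinarith
  have h2 : x ≠ 0 := by linarith
  have d1 : HasDerivAt (fun t : ℝ => t ^ 2 - 1) (2 * x) x := by
    simpa using (hasDerivAt_pow 2 x).sub_const 1
  have d2 := (hasDerivAt_zpow p (x ^ 2 - 1) (Or.inl h1)).comp x d1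
  have d3 := hasDerivAt_zpow (-q) x (Or.inl h2)
  have d4 := d2.mul d3
  refine d4.congr_deriv ?_
  simp only [Phi, Function.comp_apply]
  rw [zpow_sub_one₀ h1, zpow_sub_one₀ h2]
  push_cast
  field_simp
  ring

lemma Phi_ne (p q : ℤ) {x : ℝ} (hx : 1 < x) : Phi p q x ≠ 0 := by
  have h1 : x ^ 2 - 1 ≠ 0 := by nlinarith
  have h2 : x ≠ 0 := by linarith
  exact mul_ne_zero (zpow_ne_zero _ h1) (zpow_ne_zero _ h2)

/-- The rescaled Taylor coefficients in shifted indices. -/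
def gfun (C : ℤ → ℤ → ℤ → ℤ → ℝ × ℝ → ℝ) (n : ℕ) (d m : ℤ) (J I : ℕ) (x : ℝ) : ℝ :=
  if n + 1 < J then 0 else
    Phi (((I : ℤ) - 1) + 2 * ((J : ℤ) - 1)) (3 * ((I : ℤ) - 1) + 4 * ((J : ℤ) - 1)) x
      * Dy (n + 1 - J) (C ((I : ℤ) - 1) ((J : ℤ) - 1) (d - I - J + 2) m) (x, 0)
      / ((n + 1 - J).factorial : ℝ)

lemma PInt.core {C : ℤ → ℤ → ℤ → ℤ → ℝ × ℝ → ℝ} (hC : PInt C) (n : ℕ) (hn1 : 1 ≤ n) (hn6 : n ≤ 6) (m : ℤ)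
    (hV : ∀ i j k m, ∀ s : ℕ, (s : ℤ) + j < n → ∀ x, 1 < x → Dy s (C i j k m) (x, 0) = 0)
    (hm : ∀ i j k, ∀ s : ℕ, (s : ℤ) + j ≤ n → ∀ x, 1 < x → Dy s (C i j k (m - 2)) (x, 0) = 0)
    (d : ℤ) (hd : d ≤ 6) (i j : ℤ) (s : ℕ) (hs : (s : ℤ) + j = n) (x : ℝ) (hx : 1 < x) :
    Dy s (C i j (d - i - j) m) (x, 0) = 0 := by
  have hCz : ∀ i j k m, (i < 0 ∨ j < 0 ∨ k < 0 ∨ m < 0 ∨ 6 < i + j + k + m) → ∀ l : ℕ, ∀ b,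
      Dy l (C i j k m) b = 0 := by
    intro i j k m h l b
    rw [hC.neg i j k m h, Dy_fun_zero]; rfl
  by_cases hij : i < 0 ∨ j < 0
  · exact hCz _ _ _ _ (by omega) _ _
  have key : ∀ J I x, 1 < x → gfun C n d m J I x = 0 := by
    have up : ∀ J I : ℕ, J ≤ n + 1 → ∀ x : ℝ, gfun C n d m (J + 1) I x =
        Phi (((I : ℤ) - 1) + 2 * (J : ℤ)) (3 * ((I : ℤ) - 1) + 4 * (J : ℤ)) x
        * Dy (n + 1 - J - 1) (C ((I : ℤ) - 1) J (d - I - J + 1) m) (x, 0)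
        * ((n + 1 - J : ℕ) : ℝ) / ((n + 1 - J).factorial : ℝ) := by
      intro J I hJ x
      unfold gfun
      split_ifs with h
      · have : n + 1 - J = 0 := by omega
        rw [this]; simp
      · obtain ⟨l, hl⟩ : ∃ l, n + 1 - J = l + 1 := ⟨n - J, by omega⟩
        have e1 : n + 1 - (J + 1) = l := by omega
        have e2 : ((J + 1 : ℕ) : ℤ) - 1 = J := by push_cast; ring
        have e3 : d - I - ((J + 1 : ℕ) : ℤ) + 2 = d - I - J + 1 := by push_cast; ring
        rw [hl, e1, e2, e3, Nat.factorial_succ]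
        have : (l.factorial : ℝ) ≠ 0 := by positivity
        push_cast
        try simp only [Nat.add_sub_cancel]
        field_simp
    refine partC n hn1 hn6 _ ?_ ?_ ?_
    · intro J I x hx h
      unfold gfun
      split_ifs with h1
      · rfl
      · rw [hCz _ _ _ _ (by omega)]; simp
    · intro J I hJ hI hJn x hx
      obtain ⟨l, hl⟩ : ∃ l, n + 1 - J = l := ⟨_, rfl⟩
      have hX : x ^ 2 - 1 ≠ 0 := by nlinarith
      have hx0 : x ≠ 0 := by linarith
      have E := hC.eqn n m hV hm I (J - 1) (d - I - J + 2) l (by omega) x hx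
      set p : ℤ := ((I : ℤ) - 1) + 2 * ((J : ℤ) - 1) with hp
      set q : ℤ := 3 * ((I : ℤ) - 1) + 4 * ((J : ℤ) - 1) with hq
      have g1 : gfun C n d m J I = fun x => Phi p q x * Dy l (C ((I : ℤ) - 1) ((J : ℤ) - 1) (d - I - J + 2) m) (x, 0)
          / (l.factorial : ℝ) := by
        ext x
        rw [gfun, if_neg (by omega), hl]
      have g2 : gfun C n d m J (I + 2) x = Phi p q x * ((x ^ 2 - 1) ^ 2 / x ^ 6)
          * Dy l (C ((I : ℤ) + 1) ((J : ℤ) - 1) (d - I - J + 2 - 2) m) (x, 0) / (l.factorial : ℝ) := by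
        rw [gfun, if_neg (by omega), hl]
        have e1 : ((I + 2 : ℕ) : ℤ) - 1 + 2 * ((J : ℤ) - 1) = p + 2 := by push_cast; omega
        have e2 : 3 * (((I + 2 : ℕ) : ℤ) - 1) + 4 * ((J : ℤ) - 1) = q + 6 := by push_cast; omega
        have e3 : ((I + 2 : ℕ) : ℤ) - 1 = I + 1 := by push_cast; ring
        have e4 : d - ((I + 2 : ℕ) : ℤ) - J + 2 = d - I - J + 2 - 2 := by push_cast; ring
        have e5 : Phi 2 6 x = (x ^ 2 - 1) ^ 2 / x ^ 6 := by
          simp [Phi, zpow_neg]; norm_cast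
        rw [e1, e2, e3, e4, Phi_add _ _ _ _ hx, e5]
      have g5 : gfun C n d m (J - 1) (I + 1) x = Phi p q x * (x / (x ^ 2 - 1))
          * Dy (l + 1) (C (I : ℤ) ((J : ℤ) - 1 - 1) (d - I - J + 2) m) (x, 0) / ((l + 1).factorial : ℝ) := by
        have hl2 : n + 1 - (J - 1) = l + 1 := by omega
        rw [gfun, if_neg (by omega), hl2]
        have e0 : ((J - 1 : ℕ) : ℤ) = J - 1 := by omega
        have e1 : ((I + 1 : ℕ) : ℤ) - 1 + 2 * ((J : ℤ) - 1 - 1) = p + -1 := by push_cast; omega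
        have e2 : 3 * (((I + 1 : ℕ) : ℤ) - 1) + 4 * ((J : ℤ) - 1 - 1) = q + -1 := by push_cast; omega
        have e3 : ((I + 1 : ℕ) : ℤ) - 1 = I := by push_cast; ring
        have e4 : d - ((I + 1 : ℕ) : ℤ) - (J - 1) + 2 = d - I - J + 2 := by push_cast; ring
        have e5 : Phi (-1) (-1) x = x / (x ^ 2 - 1) := by
          simp [Phi]; field_simp
        rw [e0, e1, e2, e3, e4, Phi_add _ _ _ _ hx, e5]
      have g3 : gfun C n d m (J + 1) (I - 1) x = Phi p q x * ((x ^ 2 - 1) / x)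
          * Dy (l - 1) (C ((I : ℤ) - 2) ((J : ℤ) - 1 + 1) (d - I - J + 2) m) (x, 0) * l / (l.factorial : ℝ) := by
        rw [up J (I - 1) hJn, hl]
        have e0 : ((I - 1 : ℕ) : ℤ) = I - 1 := by omega
        have e1 : (I : ℤ) - 1 - 1 + 2 * (J : ℤ) = p + 1 := by omega
        have e2 : 3 * ((I : ℤ) - 1 - 1) + 4 * (J : ℤ) = q + 1 := by omega
        have e3 : (I : ℤ) - 1 - 1 = I - 2 := by ring
        have e4 : d - ((I : ℤ) - 1) - J + 1 = d - I - J + 2 := by ring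
        have e5 : Phi 1 1 x = (x ^ 2 - 1) / x := by
          simp [Phi]; field_simp
        have e6 : (J : ℤ) - 1 + 1 = J := by ring
        rw [e0, e1, e2, e3, e4, e6, Phi_add _ _ _ _ hx, e5]
      have g4 : gfun C n d m (J + 1) (I + 1) x = Phi p q x * ((x ^ 2 - 1) ^ 3 / x ^ 7)
          * Dy (l - 1) (C (I : ℤ) ((J : ℤ) - 1 + 1) (d - I - J + 2 - 2) m) (x, 0) * l / (l.factorial : ℝ) := by
        rw [up J (I + 1) hJn, hl]
        have e1 : ((I + 1 : ℕ) : ℤ) - 1 + 2 * (J : ℤ) = p + 3 := by push_cast; omega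
        have e2 : 3 * (((I + 1 : ℕ) : ℤ) - 1) + 4 * (J : ℤ) = q + 7 := by push_cast; omega
        have e3 : ((I + 1 : ℕ) : ℤ) - 1 = I := by push_cast; ring
        have e4 : d - ((I + 1 : ℕ) : ℤ) - J + 1 = d - I - J + 2 - 2 := by push_cast; ring
        have e5 : Phi 3 7 x = (x ^ 2 - 1) ^ 3 / x ^ 7 := by
          simp [Phi, zpow_neg]; norm_cast
        have e6 : (J : ℤ) - 1 + 1 = J := by ring
        rw [e1, e2, e3, e4, e6, Phi_add _ _ _ _ hx, e5]
      have hD := ((Phi_deriv p q hx).mul (hasDerivAt_line ((hC.sm ((I : ℤ) - 1) ((J : ℤ) - 1) (d - I - J + 2) m).Dy l) hx)).div_const (l.factorial : ℝ)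
      refine ⟨_, by rw [g1]; exact hD, ?_⟩
      rw [g1, g2, g3, g4, g5, Nat.factorial_succ]
      have hf : (l.factorial : ℝ) ≠ 0 := by positivity
      have hl1 : (l : ℝ) + 1 ≠ 0 := by positivity
      have hln : (n : ℝ) - J + 2 = l + 1 := by
        have : (l : ℤ) = n + 1 - J := by omega
        have := congrArg (Int.cast : ℤ → ℝ) this
        push_cast at this
        linarith
      have hpr : (p : ℝ) = (I - 1) + 2 * (J - 1) := by rw [hp]; push_cast; ring
      have hqr : (q : ℝ) = 3 * (I - 1) + 4 * (J - 1) := by rw [hq]; push_cast; ring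
      rw [hln, hpr, hqr]
      push_cast at E ⊢
      generalize Phi p q x = φ at *
      generalize (l.factorial : ℝ) = f at *
      generalize dx (Dy l (C ((I : ℤ) - 1) ((J : ℤ) - 1) (d - I - J + 2) m)) (x, 0) = D at *
      generalize Dy l (C ((I : ℤ) - 1) ((J : ℤ) - 1) (d - I - J + 2) m) (x, 0) = u1 at *
      generalize Dy l (C ((I : ℤ) + 1) ((J : ℤ) - 1) (d - I - J + 2 - 2) m) (x, 0) = u2 at *
      generalize Dy (l - 1) (C ((I : ℤ) - 2) ((J : ℤ) - 1 + 1) (d - I - J + 2) m) (x, 0) = u3 at *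
      generalize Dy (l - 1) (C (I : ℤ) ((J : ℤ) - 1 + 1) (d - I - J + 2 - 2) m) (x, 0) = u4 at *
      generalize Dy (l + 1) (C (I : ℤ) ((J : ℤ) - 1 - 1) (d - I - J + 2) m) (x, 0) = u5 at *
      have hDD : D = ((I - 1) * (2 * (x ^ 2 - 1) * x ^ 5 * (2 * x - 3)) * u1
        - (I + 1) * (2 * (x ^ 2 - 1) ^ 3 * (x - 2)) * u2 - l * J * (6 * (x ^ 2 - 1) ^ 2 * x ^ 4) * u3
        + l * J * (2 * (x ^ 2 - 1) ^ 4) * u4 - 2 * (x ^ 2 - 1) * x ^ 6 * u5) / (2 * (x ^ 2 - 1) ^ 2 * x ^ 6) := by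
        rw [eq_div_iff (by positivity)]
        linear_combination -E
      rw [hDD]
      clear hDD E hD g1 g2 g3 g4 g5
      field_simp
      ring
    · intro J hJ hJn x hx
      obtain ⟨l, hl⟩ : ∃ l, n + 1 - J = l := ⟨_, rfl⟩
      have hX : x ^ 2 - 1 ≠ 0 := by nlinarith
      have hx0 : x ≠ 0 := by linarith
      have E := hC.eqn n m hV hm 0 (J - 1) (d - J + 2) l (by omega) x hx
      rw [hCz (0 - 1) _ _ _ (by omega), hCz (0 - 2) _ _ _ (by omega)] at E
      have hz0 : dx (Dy l (C (0 - 1) ((J : ℤ) - 1) (d - J + 2) m)) (x, 0) = 0 := by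
        rw [hC.neg (0 - 1) _ _ _ (by omega), Dy_fun_zero]
        change fderiv ℝ (fun _ => (0 : ℝ)) (x, 0) (1, 0) = 0
        simp
      rw [hz0] at E
      rw [zero_add] at E
      set p : ℤ := 2 * ((J : ℤ) - 1) with hp
      set q : ℤ := 4 * ((J : ℤ) - 1) with hq
      have g2 : gfun C n d m J 2 x = Phi p q x * ((x ^ 2 - 1) / x ^ 3)
          * Dy l (C 1 ((J : ℤ) - 1) (d - J + 2 - 2) m) (x, 0) / (l.factorial : ℝ) := by
        rw [gfun, if_neg (by omega), hl]
        have e1 : ((2 : ℕ) : ℤ) - 1 + p = p + 1 := by push_cast; omega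
        have e2 : 3 * (((2 : ℕ) : ℤ) - 1) + q = q + 3 := by push_cast; omega
        have e3 : ((2 : ℕ) : ℤ) - 1 = 1 := by norm_num
        have e4 : d - ((2 : ℕ) : ℤ) - J + 2 = d - J + 2 - 2 := by push_cast; ring
        have e5 : Phi 1 3 x = (x ^ 2 - 1) / x ^ 3 := by
          simp [Phi, zpow_neg]; norm_cast
        rw [e1, e2, e3, e4, Phi_add _ _ _ _ hx, e5]
      have g5 : gfun C n d m (J - 1) 1 x = Phi p q x * (x ^ 4 / (x ^ 2 - 1) ^ 2)
          * Dy (l + 1) (C 0 ((J : ℤ) - 1 - 1) (d - J + 2) m) (x, 0) / ((l + 1).factorial : ℝ) := by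
        have hl2 : n + 1 - (J - 1) = l + 1 := by omega
        rw [gfun, if_neg (by omega), hl2]
        have e0 : ((J - 1 : ℕ) : ℤ) = J - 1 := by omega
        have e1 : ((1 : ℕ) : ℤ) - 1 + 2 * ((J : ℤ) - 1 - 1) = p + -2 := by push_cast; omega
        have e2 : 3 * (((1 : ℕ) : ℤ) - 1) + 4 * ((J : ℤ) - 1 - 1) = q + -4 := by push_cast; omega
        have e3 : ((1 : ℕ) : ℤ) - 1 = 0 := by norm_num
        have e4 : d - ((1 : ℕ) : ℤ) - (J - 1) + 2 = d - J + 2 := by push_cast; ring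
        have e5 : Phi (-2) (-4) x = x ^ 4 / (x ^ 2 - 1) ^ 2 := by
          simp only [Phi, zpow_neg, neg_neg]; norm_cast; field_simp
        rw [e0, e1, e2, e3, e4, Phi_add _ _ _ _ hx, e5]
      have g4 : gfun C n d m (J + 1) 1 x = Phi p q x * ((x ^ 2 - 1) ^ 2 / x ^ 4)
          * Dy (l - 1) (C 0 ((J : ℤ) - 1 + 1) (d - J + 2 - 2) m) (x, 0) * l / (l.factorial : ℝ) := by
        rw [up J 1 hJn, hl]
        have e1 : ((1 : ℕ) : ℤ) - 1 + 2 * (J : ℤ) = p + 2 := by push_cast; omega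
        have e2 : 3 * (((1 : ℕ) : ℤ) - 1) + 4 * (J : ℤ) = q + 4 := by push_cast; omega
        have e3 : ((1 : ℕ) : ℤ) - 1 = 0 := by norm_num
        have e4 : d - ((1 : ℕ) : ℤ) - J + 1 = d - J + 2 - 2 := by push_cast; ring
        have e5 : Phi 2 4 x = (x ^ 2 - 1) ^ 2 / x ^ 4 := by
          simp [Phi, zpow_neg]; norm_cast
        have e6 : (J : ℤ) - 1 + 1 = J := by ring
        rw [e1, e2, e3, e4, e6, Phi_add _ _ _ _ hx, e5]
      rw [g2, g4, g5, Nat.factorial_succ]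
      have hf : (l.factorial : ℝ) ≠ 0 := by positivity
      have hl1 : (l : ℝ) + 1 ≠ 0 := by positivity
      have hln : (n : ℝ) - J + 2 = l + 1 := by
        have : (l : ℤ) = n + 1 - J := by omega
        have := congrArg (Int.cast : ℤ → ℝ) this
        push_cast at this
        linarith
      rw [hln]
      push_cast at E ⊢
      generalize Phi p q x = φ at *
      generalize (l.factorial : ℝ) = f at *
      generalize Dy l (C 1 ((J : ℤ) - 1) (d - J + 2 - 2) m) (x, 0) = u2 at *
      generalize Dy (l - 1) (C 0 ((J : ℤ) - 1 + 1) (d - J + 2 - 2) m) (x, 0) = u4 at *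
      generalize Dy (l + 1) (C 0 ((J : ℤ) - 1 - 1) (d - J + 2) m) (x, 0) = u5 at *
      clear g2 g4 g5
      have hE : (x ^ 2 - 1) * ((x ^ 2 - 1) ^ 2 * (x - 2) * u2 - l * J * (x ^ 2 - 1) ^ 3 * u4 + x ^ 6 * u5) = 0 := by
        linear_combination (-1 / 2) * E
      have hE2 := (mul_eq_zero.1 hE).resolve_left hX
      have : φ / (f * x ^ 2 * (x ^ 2 - 1)) * ((x ^ 2 - 1) ^ 2 * (x - 2) * u2 - l * J * (x ^ 2 - 1) ^ 3 * u4 + x ^ 6 * u5) = 0 := by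
        rw [hE2, mul_zero]
      rw [← this]
      field_simp
      ring
  have h := key (j.toNat + 1) (i.toNat + 1) x hx
  rw [gfun, if_neg (by omega)] at h
  have e1 : ((j.toNat + 1 : ℕ) : ℤ) - 1 = j := by omega
  have e2 : ((i.toNat + 1 : ℕ) : ℤ) - 1 = i := by omega
  have e3 : d - ((i.toNat + 1 : ℕ) : ℤ) - ((j.toNat + 1 : ℕ) : ℤ) + 2 = d - i - j := by omega
  have e4 : n + 1 - (j.toNat + 1) = s := by omega
  rw [e1, e2, e3, e4] at h
  have hf : (s.factorial : ℝ) ≠ 0 := by positivity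
  rcases div_eq_zero_iff.1 h with h | h
  · exact (mul_eq_zero.1 h).resolve_left (Phi_ne _ _ hx)
  · exact absurd h hf


lemma PInt.dzero {C : ℤ → ℤ → ℤ → ℤ → ℝ × ℝ → ℝ} (hC : PInt C) (i j k m : ℤ)
    (h : i < 0 ∨ j < 0 ∨ k < 0 ∨ m < 0 ∨ 6 < i + j + k + m) (l : ℕ) (b : ℝ × ℝ) :
    Dy l (C i j k m) b = 0 := by
  rw [hC.neg i j k m h, Dy_fun_zero]; rfl

lemma PInt.high {C : ℤ → ℤ → ℤ → ℤ → ℝ × ℝ → ℝ} (hC : PInt C) (n : ℕ) (hn : 7 ≤ n) (m : ℤ)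
    (hV : ∀ i j k m, ∀ s : ℕ, (s : ℤ) + j < n → ∀ x, 1 < x → Dy s (C i j k m) (x, 0) = 0)
    (hm : ∀ i j k, ∀ s : ℕ, (s : ℤ) + j ≤ n → ∀ x, 1 < x → Dy s (C i j k (m - 2)) (x, 0) = 0) :
    ∀ s : ℕ, ∀ i j k, (s : ℤ) + j = n → ∀ x, 1 < x → Dy s (C i j k m) (x, 0) = 0 := by
  intro s
  induction s using Nat.strong_induction_on with
  | _ s ih =>
    intro i j k hs x hx
    rcases Nat.eq_zero_or_pos s with h0 | h0
    · exact hC.dzero _ _ _ _ (by omega) _ _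
    obtain ⟨l, rfl⟩ : ∃ l, s = l + 1 := ⟨s - 1, by omega⟩
    have E := hC.eqn n m hV hm i (j + 1) k l (by push_cast at hs; omega) x hx
    have hX : x ^ 2 - 1 ≠ 0 := by nlinarith
    have hx0 : x ≠ 0 := by linarith
    have a1 : ∀ i' k' x, 1 < x → Dy l (C i' (j + 1) k' m) (x, 0) = 0 := fun i' k' x hx =>
      ih l (by omega) _ _ _ (by push_cast at hs; omega) x hx
    have a2 : ∀ i' k', (l : ℝ) * Dy (l - 1) (C i' (j + 1 + 1) k' m) (x, 0) = 0 := by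
      intro i' k'
      rcases Nat.eq_zero_or_pos l with h | h
      · simp [h]
      · rw [ih (l - 1) (by omega) _ _ _ (by push_cast at hs; omega) x hx, mul_zero]
    have a3 := dx_zero_of_line ((hC.sm (i - 1) (j + 1) k m).Dy l) (a1 _ _) hx
    rw [a1 _ _ x hx, a1 _ _ x hx, a3, add_sub_cancel_right] at E
    have : (2 * (x ^ 2 - 1) * x ^ 6) * Dy (l + 1) (C i j k m) (x, 0) = 0 := by
      linear_combination -E - ((j + 1 : ℤ) + 1) * (6 * (x ^ 2 - 1) ^ 2 * x ^ 4) * a2 (i - 2) k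
        + ((j + 1 : ℤ) + 1) * (2 * (x ^ 2 - 1) ^ 4) * a2 i (k - 2)
    exact (mul_eq_zero.1 this).resolve_left (by positivity)

lemma PInt.vanish {C : ℤ → ℤ → ℤ → ℤ → ℝ × ℝ → ℝ} (hC : PInt C)
    (h0 : ∀ i k m x, 1 < x → C i 0 k m (x, 0) = 0) :
    ∀ n : ℕ, ∀ i j k m, ∀ s : ℕ, (s : ℤ) + j = n → ∀ x, 1 < x → Dy s (C i j k m) (x, 0) = 0 := by
  intro n
  induction n using Nat.strong_induction_on with
  | _ n ihn =>
    have hV : ∀ i j k m, ∀ s : ℕ, (s : ℤ) + j < n → ∀ x, 1 < x → Dy s (C i j k m) (x, 0) = 0 := by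
      intro i j k m s hs x hx
      by_cases hj : j < 0
      · exact hC.dzero _ _ _ _ (by omega) _ _
      · exact ihn (s + j.toNat) (by omega) i j k m s (by omega) x hx
    have main : ∀ M : ℕ, ∀ m : ℤ, m < M → ∀ i j k, ∀ s : ℕ, (s : ℤ) + j = n → ∀ x, 1 < x →
        Dy s (C i j k m) (x, 0) = 0 := by
      intro M
      induction M with
      | zero =>
        intro m hm i j k s hs x hx
        exact hC.dzero _ _ _ _ (by omega) _ _
      | succ M ih =>
        intro m hmM i j k s hs x hx
        have hm : ∀ i j k, ∀ s : ℕ, (s : ℤ) + j ≤ n → ∀ x, 1 < x →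
            Dy s (C i j k (m - 2)) (x, 0) = 0 := by
          intro i j k s hs x hx
          rcases hs.lt_or_eq with h | h
          · exact hV _ _ _ _ _ h x hx
          · exact ih (m - 2) (by push_cast at hmM; omega) _ _ _ _ h x hx
        by_cases hneg : i < 0 ∨ j < 0 ∨ k < 0 ∨ m < 0 ∨ 6 < i + j + k + m
        · exact hC.dzero _ _ _ _ hneg _ _
        rcases Nat.eq_zero_or_pos n with hn | hn
        · have hs0 : s = 0 := by omega
          have hj0 : j = 0 := by omega
          subst hs0 hj0
          exact h0 i k m x hx
        by_cases hn6 : n ≤ 6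
        · have := hC.core n hn hn6 m hV hm (i + j + k) (by omega) i j s hs x hx
          rwa [show i + j + k - i - j = k by ring] at this
        · exact hC.high n (by omega) m hV hm s i j k hs x hx
    intro i j k m s hs x hx
    exact main (m.toNat + 1) m (by omega) i j k s hs x hx

lemma PInt.eq_zero {C : ℤ → ℤ → ℤ → ℤ → ℝ × ℝ → ℝ} (hC : PInt C)
    (h0 : ∀ i k m x, 1 < x → C i 0 k m (x, 0) = 0) (i j k m : ℤ) (x : ℝ) (hx : 1 < x) :
    C i j k m (x, 0) = 0 := by
  by_cases hj : j < 0
  · rw [hC.neg _ _ _ _ (by omega)]; rfl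
  · exact hC.vanish h0 j.toNat i j k m 0 (by omega) x hx

lemma PInt.line {C : ℤ → ℤ → ℤ → ℤ → ℝ × ℝ → ℝ} (hC : PInt C) (i k m : ℤ) (x : ℝ) (hx : 1 < x) :
    cA1 (i - 1) (x, 0) * C (i - 1) 0 k m (x, 0) + cA3 (i + 1) (x, 0) * C (i + 1) 0 (k - 2) m (x, 0)
    + cA4 (i + 1) (x, 0) * C (i + 1) 0 k (m - 2) (x, 0)
    + cA0 (x, 0) * dx (C (i - 1) 0 k m) (x, 0) = 0 := by
  have h := hC.rel i 0 k m (x, 0) (mem_Om0 hx)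
  have d : dy (C i (0 - 1) k m) (x, 0) = 0 := by
    rw [← Dy_zero (dy _), ← Dy_succ]; exact hC.dzero _ _ _ _ (by omega) _ _
  rw [d, hC.neg _ (0 - 2) _ _ (by omega), hC.neg _ (0 - 1) _ _ (by omega)] at h
  have e5 : cA5 ((0 : ℤ) + 1) (x, 0) = 0 := by simp [cA5]
  have e7 : cA7 ((0 : ℤ) + 1) (x, 0) = 0 := by simp [cA7]
  rw [e5, e7] at h
  simp only [Pi.zero_apply] at h
  linear_combination h

lemma PInt.odd_zero {C : ℤ → ℤ → ℤ → ℤ → ℝ × ℝ → ℝ} (hC : PInt C) (u : ℕ) :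
    ∀ k m x, 1 < x → C (2 * u + 1) 0 k m (x, 0) = 0 := by
  induction u with
  | zero =>
    have main : ∀ K : ℕ, ∀ k m : ℤ, k < K → ∀ x, 1 < x → C 1 0 k m (x, 0) = 0 := by
      intro K
      induction K using Nat.strong_induction_on with
      | _ K ih =>
        intro k m hk x hx
        by_cases hk0 : k < 0
        · rw [hC.neg _ _ _ _ (by omega)]; rfl
        have h := hC.line 0 k (m + 2) x hx
        have d : dx (C (0 - 1) 0 k (m + 2)) (x, 0) = 0 := dx_zero_of_line (hC.sm _ _ _ _)
          (fun x hx => by rw [hC.neg _ _ _ _ (by omega)]; rfl) hx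
        have r : C (0 + 1) 0 (k - 2) (m + 2) (x, 0) = 0 := by
          rw [zero_add]
          by_cases hk2 : k - 2 < 0
          · rw [hC.neg _ _ _ _ (by omega)]; rfl
          · exact ih (K - 2) (by omega) _ _ (by omega) x hx
        rw [d, r, hC.neg (0 - 1) _ _ _ (by omega), zero_add, show m + 2 - 2 = m by ring] at h
        simp only [Pi.zero_apply, mul_zero, add_zero, zero_add] at h
        refine (mul_eq_zero.1 h).resolve_left ?_
        have : (0 : ℝ) < x + 1 := by linarith
        simp [cA4]; positivity
    intro k m x hx
    simpa using main (k.toNat + 1) k m (by omega) x hx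
  | succ u ihu =>
    have main : ∀ K : ℕ, ∀ k m : ℤ, k < K → ∀ x, 1 < x → C (2 * u + 3) 0 k m (x, 0) = 0 := by
      intro K
      induction K using Nat.strong_induction_on with
      | _ K ih =>
        intro k m hk x hx
        by_cases hk0 : k < 0
        · rw [hC.neg _ _ _ _ (by omega)]; rfl
        have h := hC.line (2 * u + 2) k (m + 2) x hx
        rw [show (2 * u + 2 - 1 : ℤ) = 2 * u + 1 by ring, show (2 * u + 2 + 1 : ℤ) = 2 * u + 3 by ring] at h
        have d : dx (C (2 * u + 1) 0 k (m + 2)) (x, 0) = 0 := dx_zero_of_line (hC.sm _ _ _ _)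
          (fun x hx => ihu _ _ x hx) hx
        have r : C (2 * u + 3) 0 (k - 2) (m + 2) (x, 0) = 0 := by
          by_cases hk2 : k - 2 < 0
          · rw [hC.neg _ _ _ _ (by omega)]; rfl
          · exact ih (K - 2) (by omega) _ _ (by omega) x hx
        rw [d, r, ihu _ _ x hx, show m + 2 - 2 = m by ring] at h
        simp only [mul_zero, add_zero, zero_add] at h
        refine (mul_eq_zero.1 h).resolve_left ?_
        have : (0 : ℝ) < x + 1 := by linarith
        have h2 : ((2 * u + 2 : ℤ) : ℝ) + 1 ≠ 0 := by
          push_cast; positivity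
        simp only [cA4]; 
        refine mul_ne_zero h2 ?_
        positivity
    intro k m x hx
    have := main (k.toNat + 1) k m (by omega) x hx
    rwa [show (2 * ((u + 1 : ℕ) : ℤ) + 1) = 2 * u + 3 by push_cast; ring]

lemma ode_unique (i : ℤ) (r r' : ℝ → ℝ) (hr : ∀ x, 1 < x → HasDerivAt r (r' x) x)
    (he : ∀ x, 1 < x → cA1 i (x, 0) * r x + cA0 (x, 0) * r' x = 0) {x0 : ℝ} (hx0 : 1 < x0)
    (h0 : r x0 = 0) : ∀ x, 1 < x → r x = 0 := by
  have key : ∀ x, 1 < x → HasDerivAt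
      (fun x => r x ^ 2 * (((x + 1) ^ 5 * (x - 1)) ^ i * x ^ (-6 * i))) 0 x := by
    intro x hx
    have h1 : (x + 1) ^ 5 * (x - 1) ≠ 0 := by
      have : x + 1 ≠ 0 := by linarith
      have : x - 1 ≠ 0 := by linarith
      positivity
    have h2 : x ≠ 0 := by linarith
    have d1 : HasDerivAt (fun x : ℝ => (x + 1) ^ 5 * (x - 1)) (5 * (x + 1) ^ 4 * (x - 1) + (x + 1) ^ 5) x := by
      have := (((hasDerivAt_id x).add_const 1).pow 5).mul ((hasDerivAt_id x).sub_const 1)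
      refine this.congr_deriv ?_
      simp
    have d2 := (hasDerivAt_zpow i _ (Or.inl h1)).comp x d1
    have d3 := hasDerivAt_zpow (-6 * i) x (Or.inl h2)
    refine (((hr x hx).pow 2).mul (d2.mul d3)).congr_deriv ?_
    have e := he x hx
    have h3 : x + 1 ≠ 0 := by linarith
    have h4 : x - 1 ≠ 0 := by linarith
    simp only [cA0, cA1] at e
    have hD : r' x = i * (2 * x - 3) / ((x ^ 2 - 1) * x) * r x := by
      have h5 : x ^ 2 - 1 ≠ 0 := by nlinarith
      rw [div_mul_eq_mul_div, eq_div_iff (mul_ne_zero h5 h2)]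
      refine mul_left_cancel₀ (show 2 * ((x ^ 2 - 1) * x ^ 5) ≠ 0 by positivity) ?_
      linear_combination -e
    simp only [Function.comp_apply, Pi.pow_apply, Pi.mul_apply]
    rw [zpow_sub_one₀ h1, zpow_sub_one₀ h2, hD]
    have h6 : x ^ 2 - 1 = (x + 1) * (x - 1) := by ring
    rw [h6]
    push_cast
    field_simp
    ring
  intro x hx
  have hc : ∀ x ∈ Set.Ioi (1 : ℝ), ∀ y ∈ Set.Ioi (1 : ℝ), (fun x => r x ^ 2 * (((x + 1) ^ 5 * (x - 1)) ^ i * x ^ (-6 * i))) x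
      = (fun x => r x ^ 2 * (((x + 1) ^ 5 * (x - 1)) ^ i * x ^ (-6 * i))) y := by
    intro x hx y hy
    refine isOpen_Ioi.is_const_of_deriv_eq_zero isPreconnected_Ioi
      (fun x hx => (key x hx).differentiableAt.differentiableWithinAt) (fun x hx => (key x hx).deriv) hx hy
  have := hc x hx x0 hx0
  simp only [h0] at this
  have h1 : (x + 1) ^ 5 * (x - 1) ≠ 0 := by
    have : x + 1 ≠ 0 := by linarith
    have : x - 1 ≠ 0 := by linarith
    positivity
  have h2 : x ≠ 0 := by linarith
  simp only [ne_eq, OfNat.ofNat_ne_zero, not_false_eq_true, zero_pow, zero_mul] at this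
  have h3 := (mul_eq_zero.1 this).resolve_right (mul_ne_zero (zpow_ne_zero _ h1) (zpow_ne_zero _ h2))
  exact pow_eq_zero_iff (by norm_num) |>.1 h3

lemma PInt.of_point {C : ℤ → ℤ → ℤ → ℤ → ℝ × ℝ → ℝ} (hC : PInt C) {x0 : ℝ} (hx0 : 1 < x0)
    (h0 : ∀ i k m, C i 0 k m (x0, 0) = 0) : ∀ i k m x, 1 < x → C i 0 k m (x, 0) = 0 := by
  have main : ∀ M : ℕ, ∀ i k m : ℤ, 7 - (M : ℤ) < i → ∀ x, 1 < x → C i 0 k m (x, 0) = 0 := by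
    intro M
    induction M with
    | zero =>
      intro i k m hi x hx
      by_cases h : i < 0 ∨ k < 0 ∨ m < 0
      · rw [hC.neg _ _ _ _ (by omega)]; rfl
      · rw [hC.neg _ _ _ _ (by push_cast at hi; omega)]; rfl
    | succ M ih =>
      intro i k m hi x hx
      refine ode_unique i (fun x => C i 0 k m (x, 0)) (fun x => dx (C i 0 k m) (x, 0))
        (fun x hx => hasDerivAt_line (hC.sm _ _ _ _) hx) ?_ hx0 (h0 _ _ _) x hx
      intro x hx
      have h := hC.line (i + 1) k m x hx
      rw [ih (i + 1 + 1) _ _ (by push_cast at hi; omega) x hx,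
        ih (i + 1 + 1) _ _ (by push_cast at hi; omega) x hx, add_sub_cancel_right] at h
      push_cast at h
      rw [add_sub_cancel_right] at h
      linear_combination h
  intro i k m x hx
  exact main (8 + (-i).toNat) i k m (by push_cast; omega) x hx

/-! ### Part A: polynomial representations -/

/-- The ring of functions smooth on the reduced domain. -/
def SmR : Subring (ℝ × ℝ → ℝ) where
  carrier := {f | Sm f}
  mul_mem' := fun {_ _} hf hg => ContDiffOn.mul hf hg
  one_mem' := contDiffOn_const
  add_mem' := fun {_ _} hf hg => ContDiffOn.add hf hg
  zero_mem' := contDiffOn_const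
  neg_mem' := fun {_} hf => ContDiffOn.neg hf

/-- Evaluation of smooth functions at a point. -/
def evR (b : ℝ × ℝ) : SmR →+* ℝ := (Pi.evalRingHom (fun _ : ℝ × ℝ => ℝ) b).comp SmR.subtype

lemma evR_apply (b : ℝ × ℝ) (f : SmR) : evR b f = (f : ℝ × ℝ → ℝ) b := rfl

/-- Base point. -/
def bp (z : PhasePt) : ℝ × ℝ := (z 0, z 1)
/-- Momentum. -/
def mp (z : PhasePt) : Fin 4 → ℝ := ![z 4, z 5, z 6, z 7]

lemma bp_mem {z : PhasePt} (hz : z ∈ TStar) : bp z ∈ Om := hz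

lemma isOpen_TStar : IsOpen TStar := by
  have h1 : IsOpen {z : PhasePt | 1 < z 0} := isOpen_lt continuous_const (continuous_apply 0)
  have h2 : IsOpen {z : PhasePt | -1 < z 1} := isOpen_lt continuous_const (continuous_apply 1)
  have h3 : IsOpen {z : PhasePt | z 1 < 1} := isOpen_lt (continuous_apply 1) continuous_const
  exact h1.inter (h2.inter h3)

/-- `Q` represents `J`. -/
def RepBy (Q : MvPolynomial (Fin 4) SmR) (J : PhasePt → ℝ) : Prop :=
  ∀ z ∈ TStar, J z = Q.eval₂ (evR (bp z)) (mp z)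

def PRep (d : ℕ) (J : PhasePt → ℝ) : Prop :=
  ∃ Q : MvPolynomial (Fin 4) SmR, Q.totalDegree ≤ d ∧ RepBy Q J

lemma PRep.mono {d d' : ℕ} {J : PhasePt → ℝ} (h : PRep d J) (hd : d ≤ d') : PRep d' J := by
  obtain ⟨Q, h1, h2⟩ := h
  exact ⟨Q, h1.trans hd, h2⟩

lemma PRep.add {d : ℕ} {J K : PhasePt → ℝ} (h : PRep d J) (h' : PRep d K) : PRep d (fun z => J z + K z) := by
  obtain ⟨Q, h1, h2⟩ := h
  obtain ⟨R, h3, h4⟩ := h'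
  refine ⟨Q + R, (MvPolynomial.totalDegree_add _ _).trans (max_le h1 h3), fun z hz => ?_⟩
  rw [MvPolynomial.eval₂_add, ← h2 z hz, ← h4 z hz]

lemma PRep.mul {d d' : ℕ} {J K : PhasePt → ℝ} (h : PRep d J) (h' : PRep d' K) :
    PRep (d + d') (fun z => J z * K z) := by
  obtain ⟨Q, h1, h2⟩ := h
  obtain ⟨R, h3, h4⟩ := h'
  refine ⟨Q * R, (MvPolynomial.totalDegree_mul _ _).trans (add_le_add h1 h3), fun z hz => ?_⟩
  rw [MvPolynomial.eval₂_mul, ← h2 z hz, ← h4 z hz]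

lemma PRep.coef {f : ℝ × ℝ → ℝ} (hf : Sm f) : PRep 0 (fun z => f (bp z)) := by
  refine ⟨MvPolynomial.C ⟨f, hf⟩, by simp, fun z hz => ?_⟩
  rw [MvPolynomial.eval₂_C]; rfl

lemma PRep.const (c : ℝ) : PRep 0 (fun _ => c) := PRep.coef (f := fun _ => c) contDiffOn_const

lemma PRep.pow {d : ℕ} {J : PhasePt → ℝ} (h : PRep d J) (n : ℕ) : PRep (n * d) (fun z => J z ^ n) := by
  induction n with
  | zero => simpa using PRep.const 1
  | succ n ih =>
    have := ih.mul h
    refine (this.mono (by ring_nf; exact le_rfl))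

lemma PRep.sum {ι : Type*} {d : ℕ} (s : Finset ι) (J : ι → PhasePt → ℝ) (h : ∀ i ∈ s, PRep d (J i)) :
    PRep d (fun z => ∑ i ∈ s, J i z) := by
  classical
  induction s using Finset.induction_on with
  | empty => simpa using (PRep.const 0).mono (Nat.zero_le d)
  | insert a s ha ih =>
    simp only [Finset.sum_insert ha]
    exact (h a (by simp)).add (ih fun i hi => h i (by simp [hi]))

lemma PRep.momX (a : Fin 4) : PRep 1 (fun z => mp z a) := by
  refine ⟨MvPolynomial.X a, by simp [MvPolynomial.totalDegree_X], fun z hz => ?_⟩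
  rw [MvPolynomial.eval₂_X]

/-- Coefficient with integer indices. -/
def cz {R : Type*} [CommSemiring R] (p : MvPolynomial (Fin 4) R) (v : Fin 4 → ℤ) : R :=
  if ∀ a, 0 ≤ v a then p.coeff (Finsupp.equivFunOnFinite.symm (fun a => (v a).toNat)) else 0

lemma cz_add {R : Type*} [CommSemiring R] (p q : MvPolynomial (Fin 4) R) (v : Fin 4 → ℤ) :
    cz (p + q) v = cz p v + cz q v := by
  unfold cz; split_ifs <;> simp

lemma cz_C_mul {R : Type*} [CommSemiring R] (c : R) (p : MvPolynomial (Fin 4) R) (v : Fin 4 → ℤ) :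
    cz (MvPolynomial.C c * p) v = c * cz p v := by
  unfold cz; split_ifs <;> simp

lemma cz_map {R S : Type*} [CommSemiring R] [CommSemiring S] (f : R →+* S)
    (p : MvPolynomial (Fin 4) R) (v : Fin 4 → ℤ) :
    cz (MvPolynomial.map f p) v = f (cz p v) := by
  unfold cz; split_ifs <;> simp [MvPolynomial.coeff_map]

lemma cz_X_mul {R : Type*} [CommSemiring R] (a : Fin 4) (p : MvPolynomial (Fin 4) R) (v : Fin 4 → ℤ) :
    cz (MvPolynomial.X a * p) v = cz p (v - Pi.single a 1) := by
  unfold cz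
  by_cases h : ∀ c, 0 ≤ v c
  · rw [if_pos h, MvPolynomial.coeff_X_mul']
    by_cases ha : v a = 0
    · rw [if_neg (by simp [ha]), if_neg]
      intro h2
      have := h2 a
      simp [ha] at this
    · have hpos : 0 < v a := lt_of_le_of_ne (h a) (Ne.symm ha)
      rw [if_pos, if_pos]
      · congr 1
        ext c
        by_cases hc : c = a
        · subst hc; simp
        · simp [hc, Finsupp.single_apply, Ne.symm hc]
      · intro c
        by_cases hc : c = a
        · subst hc; simp; omega
        · simp [hc]; exact h c
      · simp; omega
  · rw [if_neg h, if_neg]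
    intro h2
    apply h
    intro c
    have := h2 c
    by_cases hc : c = a
    · subst hc; simp at this; omega
    · simpa [hc] using this

lemma cz_pderiv (a : Fin 4) (p : MvPolynomial (Fin 4) ℝ) (v : Fin 4 → ℤ) :
    cz (MvPolynomial.pderiv a p) v = (v a + 1) * cz p (v + Pi.single a 1) := by
  unfold cz
  by_cases h : ∀ c, 0 ≤ v c
  · rw [if_pos h, if_pos, MvPolynomial.coeff_pderiv]
    · have e : (Finsupp.equivFunOnFinite.symm (fun c => (v c).toNat) + Finsupp.single a 1 : Fin 4 →₀ ℕ)
          = Finsupp.equivFunOnFinite.symm (fun c => ((v + Pi.single a 1 : Fin 4 → ℤ) c).toNat) := by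
        ext c
        by_cases hc : c = a
        · subst hc; have := h c; simp; omega
        · simp [hc, Finsupp.single_apply, Ne.symm hc]
      rw [e]
      have e2 : ((v a).toNat : ℝ) = v a := by
        have := Int.toNat_of_nonneg (h a)
        exact_mod_cast congrArg (Int.cast : ℤ → ℝ) this
      simp [e2]
      try ring
    · intro c
      by_cases hc : c = a
      · subst hc; have := h c; simp; omega
      · simp [hc]; exact h c
  · rw [if_neg h]
    split_ifs with h2
    · have : v a = -1 := by
        push Not at h
        obtain ⟨c, hc⟩ := h
        have h3 := h2 c
        by_cases hca : c = a
        · subst hca; simp at h3; omega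
        · simp [hca] at h3; omega
      simp [this]
    · simp

lemma eval_pderiv (q : MvPolynomial (Fin 4) ℝ) (p : Fin 4 → ℝ) (a : Fin 4) :
    HasDerivAt (fun t => MvPolynomial.eval (Function.update p a t) q)
      (MvPolynomial.eval p (MvPolynomial.pderiv a q)) (p a) := by
  induction q using MvPolynomial.induction_on with
  | C c => simpa using hasDerivAt_const (p a) c
  | add q r hq hr => simp only [map_add]; exact hq.add hr
  | mul_X q c hq =>
    have hX : HasDerivAt (fun t => Function.update p a t c) (if c = a then 1 else 0) (p a) := by
      by_cases hc : c = a
      · subst hc; simpa using hasDerivAt_id' (p c)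
      · simpa [hc] using hasDerivAt_const (p a) (p c)
    have := hq.mul hX
    simp only [map_mul, MvPolynomial.eval_X]
    refine this.congr_deriv ?_
    simp [MvPolynomial.pderiv_X, Derivation.leibniz, Pi.single_apply]
    by_cases hc : c = a
    · subst hc; simp; ring
    · simp [hc]; ring

lemma pd_of_line {J : PhasePt → ℝ} {z : PhasePt} (hJ : DifferentiableAt ℝ J z) (i : Fin 8) {d : ℝ}
    (h : HasDerivAt (fun t => J (Function.update z i t)) d (z i)) : pd i J z = d := by
  have h1 : HasFDerivAt J (fderiv ℝ J z) (Function.update z i (z i)) := by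
    rw [Function.update_eq_self]; exact hJ.hasFDerivAt
  have h2 := hasDerivAt_update z i (z i)
  exact (h1.comp_hasDerivAt (z i) h2).unique h

lemma line_of_pd {J : PhasePt → ℝ} {z : PhasePt} (hJ : DifferentiableAt ℝ J z) (i : Fin 8) :
    HasDerivAt (fun t => J (Function.update z i t)) (pd i J z) (z i) := by
  have h1 : HasFDerivAt J (fderiv ℝ J z) (Function.update z i (z i)) := by
    rw [Function.update_eq_self]; exact hJ.hasFDerivAt
  exact h1.comp_hasDerivAt (z i) (hasDerivAt_update z i (z i))

lemma pd_congr {J K : PhasePt → ℝ} (h : Set.EqOn J K TStar) {z : PhasePt} (hz : z ∈ TStar) (i : Fin 8) :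
    pd i J z = pd i K z := by
  unfold pd
  rw [Filter.EventuallyEq.fderiv_eq (Filter.mem_of_superset (isOpen_TStar.mem_nhds hz) h)]

/-- The function represented by `Q`. -/
def fnQ (Q : MvPolynomial (Fin 4) SmR) (z : PhasePt) : ℝ :=
  ∑ s ∈ Q.support, (Q.coeff s).1 (bp z) * (z 4 ^ s 0 * z 5 ^ s 1 * z 6 ^ s 2 * z 7 ^ s 3)

lemma fnQ_eq (Q : MvPolynomial (Fin 4) SmR) (z : PhasePt) :
    fnQ Q z = Q.eval₂ (evR (bp z)) (mp z) := by
  rw [MvPolynomial.eval₂_eq']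
  refine Finset.sum_congr rfl fun s _ => ?_
  simp [Fin.prod_univ_four, mp, evR_apply]

lemma fnQ_eval (Q : MvPolynomial (Fin 4) SmR) (z : PhasePt) :
    fnQ Q z = MvPolynomial.eval (mp z) (MvPolynomial.map (evR (bp z)) Q) := by
  rw [fnQ_eq, MvPolynomial.eval_map]

lemma RepBy.eqOn {Q : MvPolynomial (Fin 4) SmR} {J : PhasePt → ℝ} (h : RepBy Q J) :
    Set.EqOn J (fnQ Q) TStar := fun z hz => by rw [fnQ_eq, h z hz]

lemma fnQ_diff (Q : MvPolynomial (Fin 4) SmR) {z : PhasePt} (hz : z ∈ TStar) :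
    DifferentiableAt ℝ (fnQ Q) z := by
  unfold fnQ
  refine DifferentiableAt.fun_sum fun s _ => ?_
  have h1 : DifferentiableAt ℝ (Q.coeff s).1 (bp z) := Sm.diffAt (Q.coeff s).2 (bp_mem hz)
  have h2 : DifferentiableAt ℝ bp z := by unfold bp; fun_prop
  have h3 : DifferentiableAt ℝ (fun z => (Q.coeff s).1 (bp z)) z := h1.comp z h2
  refine h3.mul ?_
  fun_prop

/-- Coefficientwise directional derivative at a base point. -/
def derQ (Q : MvPolynomial (Fin 4) SmR) (b v : ℝ × ℝ) : MvPolynomial (Fin 4) ℝ :=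
  ∑ s ∈ Q.support, MvPolynomial.monomial s (fderiv ℝ (Q.coeff s).1 b v)

lemma derQ_coeff (Q : MvPolynomial (Fin 4) SmR) (b v : ℝ × ℝ) (s : Fin 4 →₀ ℕ) :
    (derQ Q b v).coeff s = fderiv ℝ (Q.coeff s).1 b v := by
  unfold derQ
  rw [MvPolynomial.coeff_sum]
  simp only [MvPolynomial.coeff_monomial]
  rw [Finset.sum_ite_eq']
  split_ifs with h
  · rfl
  · rw [MvPolynomial.notMem_support_iff.1 h]
    change 0 = fderiv ℝ (fun _ => (0 : ℝ)) b v
    simp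

lemma derQ_cz (Q : MvPolynomial (Fin 4) SmR) (b v : ℝ × ℝ) (w : Fin 4 → ℤ) :
    cz (derQ Q b v) w = fderiv ℝ (cz Q w).1 b v := by
  unfold cz
  split_ifs
  · exact derQ_coeff _ _ _ _
  · change 0 = fderiv ℝ (fun _ => (0 : ℝ)) b v
    simp

lemma derQ_eval (Q : MvPolynomial (Fin 4) SmR) (b v : ℝ × ℝ) (p : Fin 4 → ℝ) :
    MvPolynomial.eval p (derQ Q b v) = ∑ s ∈ Q.support, fderiv ℝ (Q.coeff s).1 b v
      * (p 0 ^ s 0 * p 1 ^ s 1 * p 2 ^ s 2 * p 3 ^ s 3) := by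
  unfold derQ
  rw [map_sum]
  refine Finset.sum_congr rfl fun s _ => ?_
  rw [MvPolynomial.eval_monomial, Finsupp.prod_fintype _ _ (by simp), Fin.prod_univ_four]

lemma pd_mom (Q : MvPolynomial (Fin 4) SmR) {z : PhasePt} (hz : z ∈ TStar) (a : Fin 4) (i : Fin 8)
    (hi : i.1 = a.1 + 4) :
    pd i (fnQ Q) z = MvPolynomial.eval (mp z) (MvPolynomial.pderiv a (MvPolynomial.map (evR (bp z)) Q)) := by
  refine pd_of_line (fnQ_diff Q hz) i ?_
  have h := eval_pderiv (MvPolynomial.map (evR (bp z)) Q) (mp z) a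
  have e : (fun t => fnQ Q (Function.update z i t)) =
      fun t => MvPolynomial.eval (Function.update (mp z) a t) (MvPolynomial.map (evR (bp z)) Q) := by
    ext t
    rw [fnQ_eval]
    obtain ⟨i, hi8⟩ := i
    simp only at hi
    subst hi
    fin_cases a <;> (
      congr 2
      ext c
      fin_cases c <;> simp [mp, Function.update])
  have e2 : z i = mp z a := by
    obtain ⟨i, hi8⟩ := i
    simp only at hi
    subst hi
    fin_cases a <;> simp [mp]
  rw [e, e2]
  exact h

lemma pd_x (Q : MvPolynomial (Fin 4) SmR) {z : PhasePt} (hz : z ∈ TStar) :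
    pd 0 (fnQ Q) z = MvPolynomial.eval (mp z) (derQ Q (bp z) (1, 0)) := by
  refine pd_of_line (fnQ_diff Q hz) 0 ?_
  rw [derQ_eval]
  unfold fnQ
  refine HasDerivAt.fun_sum fun s _ => ?_
  have h1 : HasFDerivAt (Q.coeff s).1 _ (bp z) := (Sm.diffAt (Q.coeff s).2 (bp_mem hz)).hasFDerivAt
  have h2 : HasDerivAt (fun t : ℝ => (t, z 1)) (1, 0) (z 0) :=
    (hasDerivAt_id (z 0)).prodMk (hasDerivAt_const _ (z 1))
  exact (h1.comp_hasDerivAt (z 0) h2).mul_const (z 4 ^ s 0 * z 5 ^ s 1 * z 6 ^ s 2 * z 7 ^ s 3)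

lemma pd_y (Q : MvPolynomial (Fin 4) SmR) {z : PhasePt} (hz : z ∈ TStar) :
    pd 1 (fnQ Q) z = MvPolynomial.eval (mp z) (derQ Q (bp z) (0, 1)) := by
  refine pd_of_line (fnQ_diff Q hz) 1 ?_
  rw [derQ_eval]
  unfold fnQ
  refine HasDerivAt.fun_sum fun s _ => ?_
  have h1 : HasFDerivAt (Q.coeff s).1 _ (bp z) := (Sm.diffAt (Q.coeff s).2 (bp_mem hz)).hasFDerivAt
  have h2 : HasDerivAt (fun t : ℝ => (z 0, t)) (0, 1) (z 1) :=
    (hasDerivAt_const _ (z 0)).prodMk (hasDerivAt_id (z 1))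
  exact (h1.comp_hasDerivAt (z 1) h2).mul_const (z 4 ^ s 0 * z 5 ^ s 1 * z 6 ^ s 2 * z 7 ^ s 3)

lemma pd_phi (Q : MvPolynomial (Fin 4) SmR) {z : PhasePt} (hz : z ∈ TStar) : pd 2 (fnQ Q) z = 0 :=
  pd_of_line (fnQ_diff Q hz) 2 (hasDerivAt_const (z 2) (fnQ Q z))

lemma pd_t (Q : MvPolynomial (Fin 4) SmR) {z : PhasePt} (hz : z ∈ TStar) : pd 3 (fnQ Q) z = 0 :=
  pd_of_line (fnQ_diff Q hz) 3 (hasDerivAt_const (z 3) (fnQ Q z))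

/-! The Hamiltonian -/

def fa (b : ℝ × ℝ) : ℝ := (b.1 ^ 2 - 1) * (b.1 ^ 2 - b.2 ^ 2) ^ 3 / ((b.1 + 1) ^ 6 * (b.1 - 1) ^ 2)
def fb (b : ℝ × ℝ) : ℝ := (1 - b.2 ^ 2) * (b.1 ^ 2 - b.2 ^ 2) ^ 3 / ((b.1 + 1) ^ 6 * (b.1 - 1) ^ 2)
def fe (b : ℝ × ℝ) : ℝ := (b.1 - 1) / ((b.1 + 1) ^ 3 * (1 - b.2 ^ 2))
def ff (b : ℝ × ℝ) : ℝ := (b.1 + 1) ^ 2 / (b.1 - 1) ^ 2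

lemma Om_pos {b : ℝ × ℝ} (hb : b ∈ Om) : 0 < b.1 - 1 ∧ 0 < b.1 + 1 ∧ 0 < 1 - b.2 ^ 2 ∧ 0 < b.1 ^ 2 - b.2 ^ 2 := by
  obtain ⟨h1, h2, h3⟩ := hb
  refine ⟨by linarith, by linarith, by nlinarith, by nlinarith⟩

lemma sm_fa : Sm fa := by
  refine ContDiffOn.div (by fun_prop) (by fun_prop) fun b hb => ?_
  obtain ⟨h1, h2, h3, h4⟩ := Om_pos hb
  positivity
lemma sm_fb : Sm fb := by
  refine ContDiffOn.div (by fun_prop) (by fun_prop) fun b hb => ?_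
  obtain ⟨h1, h2, h3, h4⟩ := Om_pos hb
  positivity
lemma sm_fe : Sm fe := by
  refine ContDiffOn.div (by fun_prop) (by fun_prop) fun b hb => ?_
  obtain ⟨h1, h2, h3, h4⟩ := Om_pos hb
  positivity
lemma sm_ff : Sm ff := by
  refine ContDiffOn.div (by fun_prop) (by fun_prop) fun b hb => ?_
  obtain ⟨h1, h2, h3, h4⟩ := Om_pos hb
  positivity

/-- Simplified Hamiltonian. -/
def Hs (z : PhasePt) : ℝ := (1 / 2) * (fa (bp z) * z 4 ^ 2 + fb (bp z) * z 5 ^ 2 + fe (bp z) * z 6 ^ 2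
  - ff (bp z) * z 7 ^ 2)

lemma Ham_eq : Set.EqOn Ham Hs TStar := by
  intro z hz
  obtain ⟨h1, h2, h3, h4⟩ := Om_pos (bp_mem hz)
  simp only [Hs, Ham, fa, fb, fe, ff, bp] at *
  have h5 : 0 < z 0 ^ 2 - 1 := by nlinarith
  have h6 : z 0 ^ 2 - 1 = (z 0 + 1) * (z 0 - 1) := by ring
  rw [h6]
  field_simp
  try ring

lemma contDiffOn_Hs : ContDiffOn ℝ (⊤ : ℕ∞) Hs TStar := by
  have hb : ContDiffOn ℝ (⊤ : ℕ∞) bp TStar := by unfold bp; fun_prop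
  have a := ContDiffOn.comp sm_fa hb (fun z hz => bp_mem hz)
  have b := ContDiffOn.comp sm_fb hb (fun z hz => bp_mem hz)
  have e := ContDiffOn.comp sm_fe hb (fun z hz => bp_mem hz)
  have f := ContDiffOn.comp sm_ff hb (fun z hz => bp_mem hz)
  have m : ∀ i : Fin 8, ContDiffOn ℝ (⊤ : ℕ∞) (fun z : PhasePt => z i ^ 2) TStar := fun i => by fun_prop
  exact contDiffOn_const.mul ((((a.mul (m 4)).add (b.mul (m 5))).add (e.mul (m 6))).sub (f.mul (m 7)))

lemma contDiffOn_Ham : ContDiffOn ℝ (⊤ : ℕ∞) Ham TStar := contDiffOn_Hs.congr Ham_eq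

lemma rep_Ham : PRep 2 (fun z => 2 * Ham z) := by
  have h : PRep 2 (fun z => (fa (bp z) * mp z 0 ^ 2 + fb (bp z) * mp z 1 ^ 2) + (fe (bp z) * mp z 2 ^ 2
    + (-1 * ff (bp z)) * mp z 3 ^ 2)) := by
    refine ((((PRep.coef sm_fa).mul ((PRep.momX 0).pow 2)).add ((PRep.coef sm_fb).mul ((PRep.momX 1).pow 2))).add
      (((PRep.coef sm_fe).mul ((PRep.momX 2).pow 2)).add ((PRep.coef (sm_ff.smul (-1))).mul ((PRep.momX 3).pow 2))))
  obtain ⟨Q, h1, h2⟩ := h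
  refine ⟨Q, h1, fun z hz => ?_⟩
  rw [← h2 z hz]
  beta_reduce
  rw [Ham_eq hz]
  simp only [Hs, mp, Matrix.cons_val]
  ring

lemma Hs_diff {z : PhasePt} (hz : z ∈ TStar) : DifferentiableAt ℝ Hs z :=
  (contDiffOn_Hs.contDiffAt (isOpen_TStar.mem_nhds hz)).differentiableAt (by simp)

lemma Ham_diff {z : PhasePt} (hz : z ∈ TStar) : DifferentiableAt ℝ Ham z :=
  (contDiffOn_Ham.contDiffAt (isOpen_TStar.mem_nhds hz)).differentiableAt (by simp)

/-- Common denominator. -/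
def Nk (b : ℝ × ℝ) : ℝ := (1 - b.2 ^ 2) ^ 2 * (b.1 ^ 2 - 1) * ((b.1 + 1) ^ 6 * (b.1 - 1) ^ 2)

lemma Nk_pos {b : ℝ × ℝ} (hb : b ∈ Om) : 0 < Nk b := by
  obtain ⟨h1, h2, h3, h4⟩ := Om_pos hb
  have h5 : 0 < b.1 ^ 2 - 1 := by nlinarith
  unfold Nk
  positivity

lemma pdHam0 {z : PhasePt} (hz : z ∈ TStar) : 2 * Nk (bp z) * pd 0 Ham z =
    cA1 1 (bp z) * z 4 ^ 2 + cA2 1 (bp z) * z 5 ^ 2 + cA3 1 (bp z) * z 6 ^ 2 + cA4 1 (bp z) * z 7 ^ 2 := by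
  obtain ⟨h1, h2, h3, h4⟩ := Om_pos (bp_mem hz)
  simp only [bp] at h1 h2 h3 h4
  have h1' := h1.ne'
  have h2' := h2.ne'
  have h3' := h3.ne'
  have hi := hasDerivAt_id (z 0)
  have n1 := ((hi.pow 2).sub_const 1)
  have n2 := ((hi.pow 2).sub_const (z 1 ^ 2)).pow 3
  have n3 := ((hi.add_const 1).pow 6).mul ((hi.sub_const 1).pow 2)
  have hN : (z 0 + 1) ^ 6 * (z 0 - 1) ^ 2 ≠ 0 := by positivity
  have da : HasDerivAt (fun t => fa (t, z 1)) _ (z 0) := (n1.mul n2).div n3 hN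
  have db : HasDerivAt (fun t => fb (t, z 1)) _ (z 0) := (n2.const_mul (1 - z 1 ^ 2)).div n3 hN
  have de : HasDerivAt (fun t => fe (t, z 1)) _ (z 0) :=
    (hi.sub_const 1).div (((hi.add_const 1).pow 3).mul_const (1 - z 1 ^ 2)) (by simp; exact ⟨h2', h3'⟩)
  have df : HasDerivAt (fun t => ff (t, z 1)) _ (z 0) :=
    ((hi.add_const 1).pow 2).div ((hi.sub_const 1).pow 2) (by simp; exact h1')
  have hH : HasDerivAt (fun t => Hs (Function.update z 0 t)) _ (z 0) :=
    ((((da.mul_const (z 4 ^ 2)).add (db.mul_const (z 5 ^ 2))).add (de.mul_const (z 6 ^ 2))).sub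
      (df.mul_const (z 7 ^ 2))).const_mul (1 / 2)
  rw [pd_congr Ham_eq hz, pd_of_line (Hs_diff hz) 0 hH]
  simp only [Nk, bp, cA1, cA2, cA3, cA4, id, Pi.pow_apply, Pi.mul_apply, Nat.cast_ofNat, Nat.add_one_sub_one]
  have h6 : z 0 ^ 2 - 1 = (z 0 + 1) * (z 0 - 1) := by ring
  rw [h6]
  field_simp
  ring

lemma pdHam1 {z : PhasePt} (hz : z ∈ TStar) : 2 * Nk (bp z) * pd 1 Ham z =
    cA5 1 (bp z) * z 4 ^ 2 + cA6 1 (bp z) * z 5 ^ 2 + cA7 1 (bp z) * z 6 ^ 2 := by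
  obtain ⟨h1, h2, h3, h4⟩ := Om_pos (bp_mem hz)
  simp only [bp] at h1 h2 h3 h4
  have h1' := h1.ne'
  have h2' := h2.ne'
  have h3' := h3.ne'
  have hi := hasDerivAt_id (z 1)
  have n1 := ((hi.pow 2).const_sub 1)
  have n2 := ((hi.pow 2).const_sub (z 0 ^ 2)).pow 3
  have da : HasDerivAt (fun t => fa (z 0, t)) _ (z 1) := (n2.const_mul (z 0 ^ 2 - 1)).div_const ((z 0 + 1) ^ 6 * (z 0 - 1) ^ 2)
  have db : HasDerivAt (fun t => fb (z 0, t)) _ (z 1) := (n1.mul n2).div_const ((z 0 + 1) ^ 6 * (z 0 - 1) ^ 2)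
  have de : HasDerivAt (fun t => fe (z 0, t)) _ (z 1) :=
    (hasDerivAt_const (z 1) (z 0 - 1)).div (n1.const_mul ((z 0 + 1) ^ 3)) (by simp; exact ⟨h2', h3'⟩)
  have df : HasDerivAt (fun t => ff (z 0, t)) _ (z 1) := hasDerivAt_const (z 1) ((z 0 + 1) ^ 2 / (z 0 - 1) ^ 2)
  have hH : HasDerivAt (fun t => Hs (Function.update z 1 t)) _ (z 1) :=
    ((((da.mul_const (z 4 ^ 2)).add (db.mul_const (z 5 ^ 2))).add (de.mul_const (z 6 ^ 2))).sub
      (df.mul_const (z 7 ^ 2))).const_mul (1 / 2)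
  rw [pd_congr Ham_eq hz, pd_of_line (Hs_diff hz) 1 hH]
  simp only [Nk, bp, cA5, cA6, cA7, id, Pi.pow_apply, Pi.mul_apply, Nat.cast_ofNat, Nat.add_one_sub_one]
  have h6 : z 0 ^ 2 - 1 = (z 0 + 1) * (z 0 - 1) := by ring
  rw [h6]
  field_simp
  ring

lemma pdHam4 {z : PhasePt} (hz : z ∈ TStar) : pd 4 Ham z = fa (bp z) * z 4 := by
  have hi := hasDerivAt_id (z 4)
  have hH : HasDerivAt (fun t => Hs (Function.update z 4 t)) _ (z 4) :=
    (((((hi.pow 2).const_mul (fa (bp z))).add_const (fb (bp z) * z 5 ^ 2)).add_const (fe (bp z) * z 6 ^ 2)).sub_const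
      (ff (bp z) * z 7 ^ 2)).const_mul (1 / 2)
  rw [pd_congr Ham_eq hz, pd_of_line (Hs_diff hz) 4 hH]
  simp; ring

lemma pdHam5 {z : PhasePt} (hz : z ∈ TStar) : pd 5 Ham z = fb (bp z) * z 5 := by
  have hi := hasDerivAt_id (z 5)
  have hH : HasDerivAt (fun t => Hs (Function.update z 5 t)) _ (z 5) :=
    (((((hi.pow 2).const_mul (fb (bp z))).const_add (fa (bp z) * z 4 ^ 2)).add_const (fe (bp z) * z 6 ^ 2)).sub_const
      (ff (bp z) * z 7 ^ 2)).const_mul (1 / 2)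
  rw [pd_congr Ham_eq hz, pd_of_line (Hs_diff hz) 5 hH]
  simp; ring

lemma Nk_fa {b : ℝ × ℝ} (hb : b ∈ Om) : 2 * Nk b * fa b = -cA0 b := by
  obtain ⟨h1, h2, h3, h4⟩ := Om_pos hb
  unfold Nk fa cA0
  field_simp

lemma Nk_fb {b : ℝ × ℝ} (hb : b ∈ Om) : 2 * Nk b * fb b = -cA8 b := by
  obtain ⟨h1, h2, h3, h4⟩ := Om_pos hb
  unfold Nk fb cA8
  field_simp

lemma pdHam2 {z : PhasePt} (hz : z ∈ TStar) : pd 2 Ham z = 0 := by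
  rw [pd_congr Ham_eq hz]
  exact pd_of_line (Hs_diff hz) 2 (hasDerivAt_const (z 2) (Hs z))

lemma pdHam3 {z : PhasePt} (hz : z ∈ TStar) : pd 3 Ham z = 0 := by
  rw [pd_congr Ham_eq hz]
  exact pd_of_line (Hs_diff hz) 3 (hasDerivAt_const (z 3) (Hs z))

/-- Integer-indexed coefficient family. -/
def CQ (Q : MvPolynomial (Fin 4) SmR) (i j k m : ℤ) : ℝ × ℝ → ℝ := (cz Q ![i, j, k, m]).1

open MvPolynomial in
lemma pint_of_rep {Q : MvPolynomial (Fin 4) SmR} {J : PhasePt → ℝ} (hQ : RepBy Q J)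
    (hd : Q.totalDegree ≤ 6) (hp : ∀ z ∈ TStar, pois Ham J z = 0) : PInt (CQ Q) := by
  refine ⟨fun i j k m => (cz Q ![i, j, k, m]).2, ?_, ?_⟩
  · intro i j k m h
    unfold CQ cz
    split_ifs with h1
    · have i0 : 0 ≤ i := h1 0
      have j0 : 0 ≤ j := h1 1
      have k0 : 0 ≤ k := h1 2
      have m0 : 0 ≤ m := h1 3
      rw [MvPolynomial.coeff_eq_zero_of_totalDegree_lt]
      · rfl
      · refine lt_of_le_of_lt hd ?_
        change 6 < Finsupp.sum _ (fun _ e => e) 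
        rw [Finsupp.sum_fintype _ _ (by simp), Fin.sum_univ_four]
        simp
        omega
    · rfl
  · intro i j k m b hb
    set q := MvPolynomial.map (evR b) Q with hq
    have big : (C (cA1 1 b) * (X 0 * (X 0 * pderiv 0 q)) + (C (cA2 1 b) * (X 1 * (X 1 * pderiv 0 q))
        + (C (cA3 1 b) * (X 2 * (X 2 * pderiv 0 q)) + (C (cA4 1 b) * (X 3 * (X 3 * pderiv 0 q))
        + (C (cA0 b) * (X 0 * derQ Q b (1, 0)) + (C (cA5 1 b) * (X 0 * (X 0 * pderiv 1 q))
        + (C (cA6 1 b) * (X 1 * (X 1 * pderiv 1 q)) + (C (cA7 1 b) * (X 2 * (X 2 * pderiv 1 q))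
        + C (cA8 b) * (X 1 * derQ Q b (0, 1)))))))))  : MvPolynomial (Fin 4) ℝ) = 0 := by
      refine MvPolynomial.funext fun p => ?_
      set z : PhasePt := ![b.1, b.2, 0, 0, p 0, p 1, p 2, p 3] with hz0
      have hz : z ∈ TStar := hb
      have hbz : bp z = b := rfl
      have hmz : mp z = p := by
        ext c; fin_cases c <;> rfl
      have h := hp z hz
      unfold pois at h
      rw [pd_congr hQ.eqOn hz 0, pd_congr hQ.eqOn hz 1, pd_congr hQ.eqOn hz 2, pd_congr hQ.eqOn hz 3,
        pd_congr hQ.eqOn hz 4, pd_congr hQ.eqOn hz 5, pd_phi Q hz, pd_t Q hz, pd_x Q hz, pd_y Q hz,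
        pd_mom Q hz 0 4 rfl, pd_mom Q hz 1 5 rfl, pdHam2 hz, pdHam3 hz, pdHam4 hz, pdHam5 hz] at h
      have a0 := pdHam0 hz
      have a1 := pdHam1 hz
      have a4 := Nk_fa hb
      have a5 := Nk_fb hb
      rw [hbz, hmz, ← hq] at h
      rw [hbz] at a0 a1
      have z4 : z 4 = p 0 := rfl
      have z5 : z 5 = p 1 := rfl
      have z6 : z 6 = p 2 := rfl
      have z7 : z 7 = p 3 := rfl
      rw [z4, z5, z6, z7] at a0
      rw [z4, z5, z6] at a1
      rw [z4, z5] at h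
      simp only [map_add, map_mul, eval_C, eval_X, map_zero]
      linear_combination (2 * Nk b) * h - (eval p (pderiv 0 q)) * a0 - (eval p (pderiv 1 q)) * a1
        + (eval p (derQ Q b (1, 0))) * p 0 * a4 + (eval p (derQ Q b (0, 1))) * p 1 * a5
    have h := congrArg (fun r => cz r ![i, j, k, m]) big
    have s0 : ∀ i j k m : ℤ, (![i, j, k, m] - Pi.single 0 1 : Fin 4 → ℤ) = ![i - 1, j, k, m] := by
      intro i j k m; ext c; fin_cases c <;> simp
    have s1 : ∀ i j k m : ℤ, (![i, j, k, m] - Pi.single 1 1 : Fin 4 → ℤ) = ![i, j - 1, k, m] := by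
      intro i j k m; ext c; fin_cases c <;> simp
    have s2 : ∀ i j k m : ℤ, (![i, j, k, m] - Pi.single 2 1 : Fin 4 → ℤ) = ![i, j, k - 1, m] := by
      intro i j k m; ext c; fin_cases c <;> simp
    have s3 : ∀ i j k m : ℤ, (![i, j, k, m] - Pi.single 3 1 : Fin 4 → ℤ) = ![i, j, k, m - 1] := by
      intro i j k m; ext c; fin_cases c <;> simp
    have t0 : ∀ i j k m : ℤ, (![i, j, k, m] + Pi.single 0 1 : Fin 4 → ℤ) = ![i + 1, j, k, m] := by
      intro i j k m; ext c; fin_cases c <;> simp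
    have t1 : ∀ i j k m : ℤ, (![i, j, k, m] + Pi.single 1 1 : Fin 4 → ℤ) = ![i, j + 1, k, m] := by
      intro i j k m; ext c; fin_cases c <;> simp
    have c0 : cz (0 : MvPolynomial (Fin 4) ℝ) ![i, j, k, m] = 0 := by simp [cz]
    have cq : ∀ i j k m : ℤ, cz q ![i, j, k, m] = CQ Q i j k m b := fun i j k m => by
      rw [hq, cz_map]; rfl
    simp only [cz_add, cz_C_mul, cz_X_mul, s0, s1, s2, s3, cz_pderiv, derQ_cz, t0, t1, c0, cq,
      Matrix.cons_val_zero, Matrix.cons_val_one] at h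
    have e1 : i - 1 - 1 + 1 = i - 1 := by ring
    have e2 : j - 1 - 1 + 1 = j - 1 := by ring
    have e3 : i - 1 - 1 = i - 2 := by ring
    have e4 : j - 1 - 1 = j - 2 := by ring
    have e5 : k - 1 - 1 = k - 2 := by ring
    have e6 : m - 1 - 1 = m - 2 := by ring
    rw [e1, e2, e3, e4, e5, e6] at h
    change _ + (_ + (_ + (_ + (cA0 b * dx (CQ Q (i - 1) j k m) b + (_ + (_ + (_ + cA8 b * dy (CQ Q i (j - 1) k m) b))))))) = 0 at h
    push_cast at h
    simp only [cA1, cA2, cA3, cA4, cA5, cA6, cA7] at h ⊢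
    linear_combination h

/-! ### Representing the integral -/

lemma pd_coord (i j : Fin 8) (z : PhasePt) : pd i (fun z : PhasePt => z j) z = if i = j then 1 else 0 := by
  have h : HasFDerivAt (fun z : PhasePt => z j) (ContinuousLinearMap.proj (R := ℝ) (φ := fun _ : Fin 8 => ℝ) j) z :=
    (ContinuousLinearMap.proj (R := ℝ) (φ := fun _ : Fin 8 => ℝ) j).hasFDerivAt
  unfold pd
  rw [h.fderiv]
  simp [Pi.single_apply, eq_comm]

lemma const_dir {J : PhasePt → ℝ} (hJ : ∀ z ∈ TStar, DifferentiableAt ℝ J z) (i : Fin 8) (hi : 2 ≤ i.1)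
    (h : ∀ z ∈ TStar, pd i J z = 0) {z : PhasePt} (hz : z ∈ TStar) (a : ℝ) :
    J (Function.update z i a) = J z := by
  have mem : ∀ t, Function.update z i t ∈ TStar := by
    intro t
    have h0 : (0 : Fin 8) ≠ i := by intro h; rw [← h] at hi; simp at hi
    have h1 : (1 : Fin 8) ≠ i := by intro h; rw [← h] at hi; simp at hi
    simpa [TStar, Function.update_of_ne h0, Function.update_of_ne h1] using hz
  have d : ∀ t, HasDerivAt (fun t => J (Function.update z i t)) 0 t := by
    intro t
    have := line_of_pd (hJ _ (mem t)) i
    rw [h _ (mem t)] at this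
    simpa using this
  have := is_const_of_deriv_eq_zero (f := fun t => J (Function.update z i t))
    (fun t => (d t).differentiableAt) (fun t => (d t).deriv) a (z i)
  simpa using this

lemma rep_of_polyMom {I : PhasePt → ℝ} (hs : ContDiffOn ℝ (⊤ : ℕ∞) I TStar) (hI : IsPolyMom 6 I)
    (h1 : ∀ z ∈ TStar, pois Pphi I z = 0) (h2 : ∀ z ∈ TStar, pois Ptm I z = 0) : PRep 6 I := by
  have hd : ∀ z ∈ TStar, DifferentiableAt ℝ I z := fun z hz =>
    (hs.contDiffAt (isOpen_TStar.mem_nhds hz)).differentiableAt (by simp)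
  have p2 : ∀ z ∈ TStar, pd 2 I z = 0 := by
    intro z hz
    have := h1 z hz
    have e : Pphi = fun z => z 6 := rfl
    simpa [pois, e, pd_coord] using this
  have p3 : ∀ z ∈ TStar, pd 3 I z = 0 := by
    intro z hz
    have := h2 z hz
    have e : Ptm = fun z => z 7 := rfl
    simpa [pois, e, pd_coord] using this
  obtain ⟨c, hc, hI⟩ := hI
  have hcs : ∀ i j k m, Sm (fun b : ℝ × ℝ => c i j k m ![b.1, b.2, 0, 0]) := by
    intro i j k m
    refine ContDiffOn.comp (hc i j k m) (f := fun b : ℝ × ℝ => (![b.1, b.2, 0, 0] : Fin 4 → ℝ)) ?_ ?_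
    · refine contDiffOn_pi.2 fun a => ?_
      fin_cases a <;> simp <;> fun_prop
    · intro b hb
      exact hb
  have key : PRep 6 (fun z => ∑ i ∈ Finset.range (6+1), ∑ j ∈ Finset.range (6+1),
      ∑ k ∈ Finset.range (6+1), ∑ m ∈ Finset.range (6+1),
        (if i + j + k + m ≤ 6 then
          c i j k m ![(bp z).1, (bp z).2, 0, 0] * (mp z 0)^i * (mp z 1)^j * (mp z 2)^k * (mp z 3)^m else 0)) := by
    refine PRep.sum _ _ fun i _ => PRep.sum _ _ fun j _ => PRep.sum _ _ fun k _ => PRep.sum _ _ fun m _ => ?_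
    by_cases h : i + j + k + m ≤ 6
    · simp only [if_pos h]
      exact (((((PRep.coef (hcs i j k m)).mul ((PRep.momX 0).pow i)).mul ((PRep.momX 1).pow j)).mul
        ((PRep.momX 2).pow k)).mul ((PRep.momX 3).pow m)).mono (by omega)
    · simp only [if_neg h]
      exact (PRep.const 0).mono (by omega)
  obtain ⟨Q, hQ1, hQ2⟩ := key
  refine ⟨Q, hQ1, fun z hz => ?_⟩
  rw [← hQ2 z hz]
  have m1 : Function.update z 2 0 ∈ TStar := hz
  rw [← const_dir hd 2 (by simp) p2 hz 0, ← const_dir hd 3 (by simp) p3 m1 0]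
  have m2 : Function.update (Function.update z 2 0) 3 0 ∈ TStar := hz
  rw [hI _ m2]
  have eb : basePt (Function.update (Function.update z 2 0) 3 0) = ![z 0, z 1, 0, 0] := by
    ext a; fin_cases a <;> simp [basePt, Function.update]
  rw [eb]
  rfl

/-- Functions whose differential is spanned by those of the known integrals. -/
def Good (J : PhasePt → ℝ) : Prop := ∀ z ∈ TStar, DifferentiableAt ℝ J z ∧
  fderiv ℝ J z ∈ Submodule.span ℝ (Set.range ![fderiv ℝ Ham z, fderiv ℝ Pphi z, fderiv ℝ Ptm z])

lemma Good.add {J K : PhasePt → ℝ} (h : Good J) (h' : Good K) : Good (fun z => J z + K z) := by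
  intro z hz
  obtain ⟨a, b⟩ := h z hz
  obtain ⟨c, d⟩ := h' z hz
  refine ⟨a.add c, ?_⟩
  rw [fderiv_fun_add a c]
  exact Submodule.add_mem _ b d

lemma Good.mul {J K : PhasePt → ℝ} (h : Good J) (h' : Good K) : Good (fun z => J z * K z) := by
  intro z hz
  obtain ⟨a, b⟩ := h z hz
  obtain ⟨c, d⟩ := h' z hz
  refine ⟨a.mul c, ?_⟩
  rw [fderiv_fun_mul a c]
  exact Submodule.add_mem _ (Submodule.smul_mem _ _ d) (Submodule.smul_mem _ _ b)

lemma Good.const (c : ℝ) : Good (fun _ => c) := by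
  intro z hz
  refine ⟨differentiableAt_const c, ?_⟩
  simp

lemma Good.pow {J : PhasePt → ℝ} (h : Good J) (n : ℕ) : Good (fun z => J z ^ n) := by
  induction n with
  | zero => simpa using Good.const 1
  | succ n ih => simpa [pow_succ] using ih.mul h

lemma Good.sum {ι : Type*} (s : Finset ι) (J : ι → PhasePt → ℝ) (h : ∀ i ∈ s, Good (J i)) :
    Good (fun z => ∑ i ∈ s, J i z) := by
  classical
  induction s using Finset.induction_on with
  | empty => simpa using Good.const 0
  | insert a s ha ih =>
    simp only [Finset.sum_insert ha]
    exact (h a (by simp)).add (ih fun i hi => h i (by simp [hi]))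

lemma good_Ham : Good Ham := fun z hz => ⟨Ham_diff hz, Submodule.subset_span ⟨0, rfl⟩⟩
lemma good_L : Good Pphi := fun z hz => ⟨by unfold Pphi; fun_prop, Submodule.subset_span ⟨1, rfl⟩⟩
lemma good_E : Good Ptm := fun z hz => ⟨by unfold Ptm; fun_prop, Submodule.subset_span ⟨2, rfl⟩⟩

/-- The Poisson bracket with `Ham` as a functional of the differential. -/
def PB (z : PhasePt) (φ : PhasePt →L[ℝ] ℝ) : ℝ :=
    (pd 0 Ham z * φ (Pi.single 4 1) - pd 4 Ham z * φ (Pi.single 0 1))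
  + (pd 1 Ham z * φ (Pi.single 5 1) - pd 5 Ham z * φ (Pi.single 1 1))
  + (pd 2 Ham z * φ (Pi.single 6 1) - pd 6 Ham z * φ (Pi.single 2 1))
  + (pd 3 Ham z * φ (Pi.single 7 1) - pd 7 Ham z * φ (Pi.single 3 1))

lemma pois_eq_PB (J : PhasePt → ℝ) (z : PhasePt) : pois Ham J z = PB z (fderiv ℝ J z) := rfl

lemma Good.pois {J : PhasePt → ℝ} (h : Good J) {z : PhasePt} (hz : z ∈ TStar)
    (h1 : pois Ham Pphi z = 0) (h2 : pois Ham Ptm z = 0) : pois Ham J z = 0 := by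
  rw [pois_eq_PB] at *
  refine Submodule.span_induction (p := fun φ _ => PB z φ = 0) ?_ ?_ ?_ ?_ (h z hz).2
  · rintro _ ⟨a, rfl⟩
    fin_cases a
    · change PB z (fderiv ℝ Ham z) = 0
      simp only [PB, pd]; ring
    · exact h1
    · exact h2
  · simp [PB]
  · intro φ ψ _ _ hφ hψ
    simp only [PB, add_apply] at *
    linear_combination hφ + hψ
  · intro a φ _ hφ
    simp only [PB, ContinuousLinearMap.smul_apply, smul_eq_mul] at *
    linear_combination a * hφ

/-- The even part of the restriction, continued by the known integrals. -/
def Pcor (Q : MvPolynomial (Fin 4) SmR) (z : PhasePt) : ℝ :=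
  ∑ s ∈ Q.support with s 1 = 0 ∧ Even (s 0), (Q.coeff s).1 (2, 0)
    * ((2 * Ham z + -fe (2, 0) * Pphi z ^ 2 + ff (2, 0) * Ptm z ^ 2) * (fa (2, 0))⁻¹) ^ (s 0 / 2)
    * Pphi z ^ s 2 * Ptm z ^ s 3

lemma Pcor_good (Q : MvPolynomial (Fin 4) SmR) : Good (Pcor Q) := by
  refine Good.sum _ _ fun s _ => ?_
  exact (((Good.const _).mul (((((((Good.const 2).mul good_Ham).add ((Good.const _).mul (good_L.pow 2)))).add
    ((Good.const _).mul (good_E.pow 2))).mul (Good.const _)).pow _)).mul (good_L.pow _)).mul (good_E.pow _)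

lemma Pcor_rep (Q : MvPolynomial (Fin 4) SmR) (hQ : Q.totalDegree ≤ 6) : PRep 6 (Pcor Q) := by
  have hL : PRep 1 Pphi := PRep.momX 2
  have hE : PRep 1 Ptm := PRep.momX 3
  refine PRep.sum _ _ fun s hs => ?_
  have h2 := ((((rep_Ham.add (((PRep.const (-fe (2, 0))).mul (hL.pow 2)).mono (by norm_num)))).add
    (((PRep.const (ff (2, 0))).mul (hE.pow 2)).mono (by norm_num))).mul (PRep.const (fa (2, 0))⁻¹)).pow (s 0 / 2)
  refine ((((PRep.const ((Q.coeff s).1 (2, 0))).mul h2).mul (hL.pow (s 2))).mul (hE.pow (s 3))).mono ?_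
  have hs1 := MvPolynomial.le_totalDegree (Finset.mem_filter.1 hs).1
  rw [Finsupp.sum_fintype _ _ (by simp), Fin.sum_univ_four] at hs1
  omega

lemma CQ_coeff (Q : MvPolynomial (Fin 4) SmR) (s : Fin 4 →₀ ℕ) :
    CQ Q (s 0) (s 1) (s 2) (s 3) = (Q.coeff s).1 := by
  unfold CQ cz
  rw [if_pos]
  · congr 2
    ext c; fin_cases c <;> simp
  · intro c; fin_cases c <;> simp

lemma Pcor_eq {Q : MvPolynomial (Fin 4) SmR} (hC : PInt (CQ Q)) {z : PhasePt} (h0 : z 0 = 2) (h1 : z 1 = 0)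
    (h5 : z 5 = 0) : Pcor Q z = fnQ Q z := by
  have hz : z ∈ TStar := by simp [TStar, h0, h1]
  have hb : bp z = (2, 0) := by simp [bp, h0, h1]
  unfold Pcor fnQ
  rw [Finset.sum_filter]
  refine Finset.sum_congr rfl fun s hs => ?_
  have hfa : fa (2, 0) ≠ 0 := by norm_num [fa]
  have hH : (2 * Ham z + -fe (2, 0) * Pphi z ^ 2 + ff (2, 0) * Ptm z ^ 2) * (fa (2, 0))⁻¹ = z 4 ^ 2 := by
    rw [Ham_eq hz, Hs, hb, h5, Pphi, Ptm]
    field_simp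
    ring
  rw [hb, hH, h5]
  by_cases hs1 : s 1 = 0
  · by_cases he : Even (s 0)
    · rw [if_pos ⟨hs1, he⟩, ← pow_mul, hs1, Nat.mul_div_cancel' he.two_dvd, Pphi, Ptm]
      ring
    · rw [if_neg (by tauto)]
      obtain ⟨u, hu⟩ := Nat.not_even_iff_odd.1 he
      have := hC.odd_zero u (s 2) (s 3) 2 (by norm_num)
      have h3 := CQ_coeff Q s
      rw [hs1, hu] at h3
      push_cast at h3
      rw [h3] at this
      rw [this, zero_mul]
  · rw [if_neg (by tauto), zero_pow hs1]
    ring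

lemma CQ_zero_of_eval {Q : MvPolynomial (Fin 4) SmR}
    (h : ∀ z : PhasePt, z 0 = 2 → z 1 = 0 → z 5 = 0 → fnQ Q z = 0) (i k m : ℤ) : CQ Q i 0 k m (2, 0) = 0 := by
  set q0 : MvPolynomial (Fin 4) ℝ := ∑ s ∈ Q.support with s 1 = 0, MvPolynomial.monomial s ((Q.coeff s).1 (2, 0))
    with hq0
  have hz : q0 = 0 := by
    refine MvPolynomial.funext fun p => ?_
    rw [map_zero, ← h ![2, 0, 0, 0, p 0, 0, p 2, p 3] rfl rfl rfl, hq0, map_sum, fnQ, Finset.sum_filter]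
    refine Finset.sum_congr rfl fun s _ => ?_
    split_ifs with hs
    · rw [MvPolynomial.eval_monomial, Finsupp.prod_fintype _ _ (by simp), Fin.prod_univ_four, hs]
      simp [bp]
    · simp [hs]
  unfold CQ cz
  split_ifs with hv
  · have := congrArg (MvPolynomial.coeff (Finsupp.equivFunOnFinite.symm fun a => ((![i, 0, k, m] : Fin 4 → ℤ) a).toNat)) hz
    rw [hq0, MvPolynomial.coeff_sum] at this
    simp only [MvPolynomial.coeff_monomial] at this
    rw [Finset.sum_ite_eq'] at this
    split_ifs at this with h3
    · simpa using this
    · rw [Finset.mem_filter] at h3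
      have h4 : (Finsupp.equivFunOnFinite.symm fun a => ((![i, 0, k, m] : Fin 4 → ℤ) a).toNat) ∉ Q.support := by
        intro h5; exact h3 ⟨h5, by simp⟩
      rw [MvPolynomial.notMem_support_iff.1 h4]; rfl
  · rfl

lemma exists_corr {I : PhasePt → ℝ} (hs : ContDiffOn ℝ (⊤ : ℕ∞) I TStar) (hI : IsPolyMom 6 I)
    (hp : ∀ z ∈ TStar, pois Ham Pphi z = 0 ∧ pois Ham Ptm z = 0 ∧ pois Pphi Ptm z = 0 ∧
        pois Ham I z = 0 ∧ pois Pphi I z = 0 ∧ pois Ptm I z = 0) :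
    ∃ P, Good P ∧ ∃ Q, RepBy Q (fun z => I z - P z) ∧ (∀ z ∈ TStar, pois Ham (fun z => I z - P z) z = 0) ∧
      ∀ z ∈ TStar, z 1 = 0 → I z = P z := by
  have hd : ∀ z ∈ TStar, DifferentiableAt ℝ I z := fun z hz =>
    (hs.contDiffAt (isOpen_TStar.mem_nhds hz)).differentiableAt (by simp)
  obtain ⟨Q, hQd, hQ⟩ := rep_of_polyMom hs hI (fun z hz => (hp z hz).2.2.2.2.1) (fun z hz => (hp z hz).2.2.2.2.2)
  have hC := pint_of_rep hQ hQd (fun z hz => (hp z hz).2.2.2.1)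
  have hG := Pcor_good Q
  obtain ⟨R, hRd, hR⟩ : PRep 6 (fun z => I z - Pcor Q z) := by
    have := (PRep.add ⟨Q, hQd, hQ⟩ (((PRep.const (-1)).mul (Pcor_rep Q hQd)).mono (by norm_num)))
    simpa [sub_eq_add_neg] using this
  have hpois : ∀ z ∈ TStar, pois Ham (fun z => I z - Pcor Q z) z = 0 := by
    intro z hz
    have e1 := (hp z hz).2.2.2.1
    have e2 := hG.pois hz (hp z hz).1 (hp z hz).2.1
    rw [pois_eq_PB] at *
    rw [fderiv_fun_sub (hd z hz) (hG z hz).1]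
    simp only [PB, sub_apply] at *
    linear_combination e1 - e2
  have hCR := pint_of_rep hR hRd hpois
  refine ⟨Pcor Q, hG, R, hR, hpois, ?_⟩
  have hpt : ∀ i k m, CQ R i 0 k m (2, 0) = 0 := CQ_zero_of_eval fun z h0 h1 h5 => by
    have hz : z ∈ TStar := by simp [TStar, h0, h1]
    rw [← hR.eqOn hz]
    beta_reduce
    rw [Pcor_eq hC h0 h1 h5, hQ.eqOn hz, sub_self]
  have hall := hCR.eq_zero (hCR.of_point (by norm_num) hpt)
  intro z hz h1
  have h := hR.eqOn hz
  beta_reduce at h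
  rw [← sub_eq_zero, h]
  refine Finset.sum_eq_zero fun s _ => ?_
  rw [← CQ_coeff, bp, h1, hall _ _ _ _ _ hz.1, zero_mul]


/-! ### The Hamiltonian flow -/

/-- The Hamiltonian vector field. -/
def XH (z : PhasePt) : PhasePt :=
  ![pd 4 Ham z, pd 5 Ham z, pd 6 Ham z, pd 7 Ham z, -pd 0 Ham z, -pd 1 Ham z, -pd 2 Ham z, -pd 3 Ham z]

lemma XH_apply (z : PhasePt) (φ : PhasePt →L[ℝ] ℝ) : φ (XH z) = - PB z φ := by
  have h : XH z = ∑ i, XH z i • (Pi.single i 1 : PhasePt) := by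
    simpa [Pi.basisFun_apply] using ((Pi.basisFun ℝ (Fin 8)).sum_repr (XH z)).symm
  rw [h, map_sum]
  simp only [map_smul, smul_eq_mul, Fin.sum_univ_eight, PB, XH]
  simp
  ring

lemma contDiffOn_pd (i : Fin 8) : ContDiffOn ℝ 1 (pd i Ham) TStar := by
  have h : ContDiffOn ℝ 1 (fderiv ℝ Ham) TStar :=
    contDiffOn_Ham.fderiv_of_isOpen isOpen_TStar (by
      have h : ((2 : ℕ∞) : WithTop ℕ∞) ≤ ((⊤ : ℕ∞) : WithTop ℕ∞) := WithTop.coe_le_coe.2 le_top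
      have e : (1 + 1 : WithTop ℕ∞) = ((2 : ℕ∞) : WithTop ℕ∞) := by norm_num
      rw [e]; exact h)
  exact h.clm_apply contDiffOn_const

lemma contDiffOn_XH : ContDiffOn ℝ 1 XH TStar := by
  refine contDiffOn_pi.2 fun a => ?_
  fin_cases a
  · exact contDiffOn_pd 4
  · exact contDiffOn_pd 5
  · exact contDiffOn_pd 6
  · exact contDiffOn_pd 7
  · exact (contDiffOn_pd 0).neg
  · exact (contDiffOn_pd 1).neg
  · exact (contDiffOn_pd 2).neg
  · exact (contDiffOn_pd 3).neg

/-- Base point on the equator. -/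
def zq : PhasePt := ![2, 0, 0, 0, 0, 1, 0, 0]

lemma zq_mem : zq ∈ TStar := by
  refine ⟨?_, ?_, ?_⟩ <;> simp [zq]

lemma XH_zq : 0 < XH zq 1 := by
  change 0 < pd 5 Ham zq
  rw [pdHam5 zq_mem]
  simp [fb, bp, zq]
  norm_num

lemma exists_flow : ∃ W ∈ nhds zq, ∃ (η : ℝ) (α : PhasePt → ℝ → PhasePt), 0 < η ∧
    ∀ z ∈ W, α z 0 = z ∧ (∀ t ∈ Set.Icc (-η) η, α z t ∈ TStar ∧
      HasDerivWithinAt (α z) (XH (α z t)) (Set.Icc (-η) η) t) ∧ α z (-η) 1 < 0 ∧ 0 < α z η 1 := by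
  obtain ⟨ε, hε, a, r, L, K, hr, hpl⟩ := IsPicardLindelof.of_contDiffAt_one
    (contDiffOn_XH.contDiffAt (isOpen_TStar.mem_nhds zq_mem))
  obtain ⟨α, hα, hc⟩ := (hpl 0).exists_forall_mem_closedBall_eq_hasDerivWithinAt_continuousOn
  simp only [zero_sub, zero_add] at hα hc
  have hball : Metric.closedBall zq (r : ℝ) ∈ nhds zq := Metric.closedBall_mem_nhds _ (by exact_mod_cast hr)
  have hI : Set.Icc (-ε) ε ∈ nhds (0 : ℝ) := Icc_mem_nhds (by linarith) hε
  have hzb : zq ∈ Metric.closedBall zq (r : ℝ) := mem_of_mem_nhds hball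
  have hcat : ∀ t ∈ Set.Ioo (-ε) ε, ContinuousAt α (zq, t) := fun t ht =>
    hc.continuousAt (prod_mem_nhds hball (Icc_mem_nhds ht.1 ht.2))
  have h0 : α (zq, 0) = zq := (hα zq hzb).1
  -- stay inside
  have hT : ∀ᶠ p in nhds (zq, (0 : ℝ)), α p ∈ TStar := by
    have := hcat 0 ⟨by linarith, hε⟩
    exact this (isOpen_TStar.mem_nhds (by rw [h0]; exact zq_mem))
  rw [nhds_prod_eq] at hT
  obtain ⟨W₁, hW₁, T₁, hT₁, hWT⟩ := Filter.mem_prod_iff.1 hT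
  obtain ⟨δ, hδ, hδT⟩ := Metric.mem_nhds_iff.1 hT₁
  -- the sign of y
  have hd : HasDerivAt (fun t => α (zq, t)) (XH zq) 0 := by
    have := ((hα zq hzb).2 0 ⟨by linarith, hε.le⟩).hasDerivAt hI
    rwa [h0] at this
  have hd1 : HasDerivAt (fun t => α (zq, t) 1) (XH zq 1) 0 := (hasDerivAt_pi.1 hd) 1
  have hsl := hd1.tendsto_slope.eventually (lt_mem_nhds XH_zq)
  rw [eventually_nhdsWithin_iff] at hsl
  obtain ⟨κ, hκ, hκs⟩ := Metric.eventually_nhds_iff.1 hsl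
  obtain ⟨η, hη0, hη⟩ := exists_between (lt_min hε (lt_min hδ hκ))
  obtain ⟨hη1, hη2⟩ := lt_min_iff.1 hη
  obtain ⟨hη2, hη3⟩ := lt_min_iff.1 hη2
  have hy0 : zq 1 = 0 := rfl
  have hpos : 0 < α (zq, η) 1 := by
    have := hκs (y := η) (by simpa [abs_of_pos hη0] using hη3) (by simpa using hη0.ne')
    simp only [slope_def_field, h0, hy0, sub_zero] at this
    exact (div_pos_iff_of_pos_right hη0).1 this
  have hneg : α (zq, -η) 1 < 0 := by
    have := hκs (y := -η) (by simpa [abs_of_pos hη0] using hη3) (by simpa using hη0.ne')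
    simp only [slope_def_field, h0, hy0, sub_zero] at this
    rw [div_neg, neg_pos] at this
    by_contra h
    push Not at h
    exact absurd this (not_lt.2 (div_nonneg h hη0.le))
  have e1 : ∀ᶠ z in nhds zq, 0 < α (z, η) 1 := by
    have h1 : ContinuousAt (fun z => α (z, η)) zq :=
      ContinuousAt.comp (f := fun z => (z, η)) (hcat η ⟨by linarith, hη1⟩) (by fun_prop)
    have h2 : ContinuousAt (fun z => α (z, η) 1) zq := (continuous_apply 1).continuousAt.comp h1
    exact h2.eventually (lt_mem_nhds hpos)
  have e2 : ∀ᶠ z in nhds zq, α (z, -η) 1 < 0 := by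
    have h1 : ContinuousAt (fun z => α (z, -η)) zq :=
      ContinuousAt.comp (f := fun z => (z, -η)) (hcat (-η) ⟨by linarith, by linarith⟩) (by fun_prop)
    have h2 : ContinuousAt (fun z => α (z, -η) 1) zq := (continuous_apply 1).continuousAt.comp h1
    exact h2.eventually (gt_mem_nhds hneg)
  refine ⟨_, Filter.inter_mem (Filter.inter_mem hball hW₁) (Filter.inter_mem e2 e1), η,
    fun z t => α (z, t), hη0, ?_⟩
  rintro z ⟨⟨hz1, hz2⟩, hz3, hz4⟩
  refine ⟨(hα z hz1).1, fun t ht => ⟨?_, ?_⟩, hz3, hz4⟩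
  · refine hWT (Set.mk_mem_prod hz2 (hδT ?_))
    rw [Metric.mem_ball, Real.dist_eq, sub_zero]
    exact (abs_le.2 ht).trans_lt hη2
  · exact ((hα z hz1).2 t ⟨by linarith [ht.1], by linarith [ht.2]⟩).mono
      (Set.Icc_subset_Icc (by linarith) hη1.le)

lemma const_on_flow {J : PhasePt → ℝ} (hJ : ∀ z ∈ TStar, DifferentiableAt ℝ J z)
    (hp : ∀ z ∈ TStar, pois Ham J z = 0) {γ : ℝ → PhasePt} {η : ℝ} (hη : 0 < η)
    (hγ : ∀ t ∈ Set.Icc (-η) η, γ t ∈ TStar ∧ HasDerivWithinAt γ (XH (γ t)) (Set.Icc (-η) η) t) :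
    ∀ t ∈ Set.Icc (-η) η, J (γ t) = J (γ (-η)) := by
  have hd : ∀ t ∈ Set.Icc (-η) η, HasDerivWithinAt (fun t => J (γ t)) 0 (Set.Icc (-η) η) t := by
    intro t ht
    have h := (hJ _ (hγ t ht).1).hasFDerivAt.comp_hasDerivWithinAt t (hγ t ht).2
    rw [XH_apply, ← pois_eq_PB, hp _ (hγ t ht).1, neg_zero] at h
    exact h
  refine constant_of_has_deriv_right_zero (fun t ht => (hd t ht).continuousWithinAt) fun t ht => ?_
  refine (hd t ⟨ht.1, ht.2.le⟩).mono_of_mem_nhdsWithin ?_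
  exact Icc_mem_nhdsGE_of_mem ht

lemma eq_near {J : PhasePt → ℝ} (hJ : ∀ z ∈ TStar, DifferentiableAt ℝ J z)
    (hp : ∀ z ∈ TStar, pois Ham J z = 0) (h0 : ∀ z ∈ TStar, z 1 = 0 → J z = 0) :
    ∀ᶠ z in nhds zq, J z = 0 := by
  obtain ⟨W, hW, η, α, hη, hα⟩ := exists_flow
  refine Filter.mem_of_superset hW fun z hz => ?_
  obtain ⟨a0, a1, a2, a3⟩ := hα z hz
  have hc := const_on_flow hJ hp hη a1
  have hcont : ContinuousOn (fun t => α z t 1) (Set.Icc (-η) η) := fun t ht =>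
    (continuous_apply 1).continuousAt.comp_continuousWithinAt (a1 t ht).2.continuousWithinAt
  obtain ⟨t, ht, hty⟩ := intermediate_value_Icc (by linarith) hcont ⟨a2.le, a3.le⟩
  have e1 := hc 0 ⟨by linarith, hη.le⟩
  have e2 := hc t ht
  rw [a0] at e1
  change J z = 0
  rw [e1, ← e2]
  exact h0 _ (a1 t ht).1 hty

lemma not_indep {I : PhasePt → ℝ} (hs : ContDiffOn ℝ (⊤ : ℕ∞) I TStar) (hI : IsPolyMom 6 I)
    (hp : ∀ z ∈ TStar, pois Ham Pphi z = 0 ∧ pois Ham Ptm z = 0 ∧ pois Pphi Ptm z = 0 ∧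
        pois Ham I z = 0 ∧ pois Pphi I z = 0 ∧ pois Ptm I z = 0) : ¬ FunIndep Ham Pphi Ptm I := by
  rintro ⟨S, hS, hSd, hli⟩
  obtain ⟨P, hG, -, -, hpo, hz⟩ := exists_corr hs hI hp
  have hd : ∀ z ∈ TStar, DifferentiableAt ℝ I z := fun z hz =>
    (hs.contDiffAt (isOpen_TStar.mem_nhds hz)).differentiableAt (by simp)
  have hev := eq_near (J := fun z => I z - P z) (fun z hz => (hd z hz).sub (hG z hz).1) hpo
    (fun z h h1 => sub_eq_zero.2 (hz z h h1))
  obtain ⟨W, hW, hWo, hWz⟩ := eventually_nhds_iff.1 hev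
  obtain ⟨z, hzW, hzS⟩ := mem_closure_iff.1 (hSd zq_mem) W hWo hWz
  have he : fderiv ℝ I z = fderiv ℝ P z := by
    refine Filter.EventuallyEq.fderiv_eq ?_
    filter_upwards [hWo.mem_nhds hzW] with w hw
    exact sub_eq_zero.1 (hW w hw)
  have hsp := (hG z (hS hzS)).2
  rw [← he] at hsp
  have hl := hli z hzS
  have := linearIndependent_fin_succ'.1 hl
  refine this.2 ?_
  have hi : Fin.init ![fderiv ℝ Ham z, fderiv ℝ Pphi z, fderiv ℝ Ptm z, fderiv ℝ I z]
      = ![fderiv ℝ Ham z, fderiv ℝ Pphi z, fderiv ℝ Ptm z] := by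
    ext i : 1
    fin_cases i <;> rfl
  rw [hi]
  exact hsp

/-- there is no smooth integral polynomial in momenta of degree ≤ 6 that is
functionally independent of `H, p_φ, p_t` and Poisson-commutes with them. -/
theorem no_nontrivial_integral_degree_le_six :
    ¬ ∃ I : PhasePt → ℝ, ContDiffOn ℝ (⊤ : ℕ∞) I TStar ∧ IsPolyMom 6 I ∧
      (∀ z ∈ TStar,
        pois Ham Pphi z = 0 ∧ pois Ham Ptm z = 0 ∧ pois Pphi Ptm z = 0 ∧
        pois Ham I z = 0 ∧ pois Pphi I z = 0 ∧ pois Ptm I z = 0) ∧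
      FunIndep Ham Pphi Ptm I := by
  rintro ⟨I, hs, hI, hp, hF⟩
  exact not_indep hs hI hp hF

end
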